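/- Under Conditions (C1)–(C6), for every integer m ≥ 1 and every choice of 0 < u_1 < u_2 < … < u_m < 1, the random vector (Z_w^π(⌊n·u_1⌋), …, Z_w^π(⌊n·u_m⌋)) under the permutation null distribution converges in distribution, as n → ∞, to a centered m-dimensional Gaussian random vector with covariance matrix C given by C_{ij} = ρ_w*(u_i, u_j) (a positive definite matrix with unit diagonal). -/

import Mathlib

open Finset Filter Asymptotics MeasureTheory ProbabilityTheory Topology

namespace RING

/-- `U1^π(t1,t2)`: sum of `R (π i) (π j)` over indices (1-based `i,j ∈ {1,…,n}`,
represented by `Fin n` with `i` standing for index `i+1`) with `t1 < i ≤ t2` and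
`t1 < j ≤ t2`. -/
noncomputable def U1 (n : ℕ) (R : Fin n → Fin n → ℝ) (π : Equiv.Perm (Fin n))
    (t1 t2 : ℕ) : ℝ :=
  ∑ i : Fin n, ∑ j : Fin n,
    if t1 ≤ (i : ℕ) ∧ (i : ℕ) < t2 ∧ t1 ≤ (j : ℕ) ∧ (j : ℕ) < t2 then R (π i) (π j) else 0

/-- `U2^π(t1,t2)`: sum of `R (π i) (π j)` over indices with `i ≤ t1` or `i > t2`,
and `j ≤ t1` or `j > t2`. -/
noncomputable def U2 (n : ℕ) (R : Fin n → Fin n → ℝ) (π : Equiv.Perm (Fin n))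
    (t1 t2 : ℕ) : ℝ :=
  ∑ i : Fin n, ∑ j : Fin n,
    if ((i : ℕ) < t1 ∨ t2 ≤ (i : ℕ)) ∧ ((j : ℕ) < t1 ∨ t2 ≤ (j : ℕ)) then R (π i) (π j) else 0

/-- Expectation under the permutation null distribution (uniform over all `n!`
permutations). -/
noncomputable def pexp (n : ℕ) (f : Equiv.Perm (Fin n) → ℝ) : ℝ :=
  (∑ π : Equiv.Perm (Fin n), f π) / (Nat.factorial n)

/-- Variance under the permutation null distribution. -/
noncomputable def pvar (n : ℕ) (f : Equiv.Perm (Fin n) → ℝ) : ℝ :=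
  pexp n (fun π => (f π - pexp n f) ^ 2)

/-- Covariance under the permutation null distribution. -/
noncomputable def pcov (n : ℕ) (f g : Equiv.Perm (Fin n) → ℝ) : ℝ :=
  pexp n (fun π => (f π - pexp n f) * (g π - pexp n g))

/-- `R̄_{i·} = (Σ_j R_{ij})/(n-1)`. -/
noncomputable def Rbar (n : ℕ) (R : Fin n → Fin n → ℝ) (i : Fin n) : ℝ :=
  (∑ j : Fin n, R i j) / ((n : ℝ) - 1)

/-- `r0 = (1/n) Σ_i R̄_{i·}`. -/
noncomputable def r0 (n : ℕ) (R : Fin n → Fin n → ℝ) : ℝ :=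
  (∑ i : Fin n, Rbar n R i) / n

/-- `r1² = (1/n) Σ_i R̄_{i·}²`. -/
noncomputable def r1sq (n : ℕ) (R : Fin n → Fin n → ℝ) : ℝ :=
  (∑ i : Fin n, (Rbar n R i) ^ 2) / n

/-- `r_d² = (1/(n(n-1))) Σ_i Σ_j R_{ij}²`. -/
noncomputable def rdsq (n : ℕ) (R : Fin n → Fin n → ℝ) : ℝ :=
  (∑ i : Fin n, ∑ j : Fin n, (R i j) ^ 2) / ((n : ℝ) * ((n : ℝ) - 1))

/-- `U_diff^π = U1^π − U2^π`. -/
noncomputable def Udiff (n : ℕ) (R : Fin n → Fin n → ℝ) (π : Equiv.Perm (Fin n))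
    (t1 t2 : ℕ) : ℝ :=
  U1 n R π t1 t2 - U2 n R π t1 t2

/-- `U_w^π = ((n−t2+t1−1)·U1^π + (t2−t1−1)·U2^π)/(n−2)`. -/
noncomputable def Uw (n : ℕ) (R : Fin n → Fin n → ℝ) (π : Equiv.Perm (Fin n))
    (t1 t2 : ℕ) : ℝ :=
  (((n : ℝ) - t2 + t1 - 1) * U1 n R π t1 t2 + ((t2 : ℝ) - t1 - 1) * U2 n R π t1 t2) /
    ((n : ℝ) - 2)

/-- Standardized `Z_w^π(t1,t2)`. -/
noncomputable def Zw (n : ℕ) (R : Fin n → Fin n → ℝ) (π : Equiv.Perm (Fin n))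
    (t1 t2 : ℕ) : ℝ :=
  (Uw n R π t1 t2 - pexp n (fun σ => Uw n R σ t1 t2)) /
    Real.sqrt (pvar n (fun σ => Uw n R σ t1 t2))

/-- Standardized `Z_diff^π(t1,t2)`. -/
noncomputable def Zdiff (n : ℕ) (R : Fin n → Fin n → ℝ) (π : Equiv.Perm (Fin n))
    (t1 t2 : ℕ) : ℝ :=
  (Udiff n R π t1 t2 - pexp n (fun σ => Udiff n R σ t1 t2)) /
    Real.sqrt (pvar n (fun σ => Udiff n R σ t1 t2))

/-- Discrete σ-algebra on the finite permutation group. -/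
instance (n : ℕ) : MeasurableSpace (Equiv.Perm (Fin n)) := ⊤

/-- The permutation null distribution: the uniform probability measure on the
`n!` permutations of `{1,…,n}`. -/
noncomputable def permP (n : ℕ) : ProbabilityMeasure (Equiv.Perm (Fin n)) :=
  ⟨(PMF.uniformOfFintype (Equiv.Perm (Fin n))).toMeasure,
    PMF.toMeasure.isProbabilityMeasure _⟩

/-- The distribution of a real-valued statistic under the permutation null
distribution. -/
noncomputable def permDist (n : ℕ) (f : Equiv.Perm (Fin n) → ℝ) : ProbabilityMeasure ℝ :=
  (permP n).map (f := f) (Measurable.aemeasurable (fun _ _ => trivial))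

/-- The centered Gaussian distribution on `ℝ` with variance `v` (for `v ≥ 0`). -/
noncomputable def gaussLimit (v : ℝ) : ProbabilityMeasure ℝ :=
  ⟨gaussianReal 0 (Real.toNNReal v), inferInstance⟩

/-- `ρ_w*(u,v) = (u∧v)(1−(u∨v))/((u∨v)(1−(u∧v)))`. -/
noncomputable def rhoW (u v : ℝ) : ℝ :=
  (min u v * (1 - max u v)) / (max u v * (1 - min u v))

/-- `ρ_diff*(u,v) = (u∧v)(1−(u∨v))/√((u∧v)(1−(u∧v))·(u∨v)(1−(u∨v)))`. -/
noncomputable def rhoDiff (u v : ℝ) : ℝ :=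
  (min u v * (1 - max u v)) /
    Real.sqrt (min u v * (1 - min u v) * (max u v * (1 - max u v)))

/-- Condition (C1): `Σ_i (Σ_j R_{ij}²)² = O(n³ r_d⁴)`. -/
def Cond1 (R : (n : ℕ) → Fin n → Fin n → ℝ) : Prop :=
  (fun n => ∑ i : Fin n, (∑ j : Fin n, (R n i j) ^ 2) ^ 2)
    =O[atTop] fun n => (n : ℝ) ^ 3 * (rdsq n (R n)) ^ 2

/-- Condition (C2): `Σ_i |R̄_{i·} − r0|³ = o((n(r1² − r0²))^{3/2})`. -/
def Cond2 (R : (n : ℕ) → Fin n → Fin n → ℝ) : Prop :=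
  (fun n => ∑ i : Fin n, |Rbar n (R n) i - r0 n (R n)| ^ 3)
    =o[atTop] fun n => ((n : ℝ) * (r1sq n (R n) - (r0 n (R n)) ^ 2)) ^ ((3 : ℝ) / 2)

/-- Condition (C3): `Σ_i (R̄_{i·} − r0)³ = o(n·r_d·(r1² − r0²))`. -/
def Cond3 (R : (n : ℕ) → Fin n → Fin n → ℝ) : Prop :=
  (fun n => ∑ i : Fin n, (Rbar n (R n) i - r0 n (R n)) ^ 3)
    =o[atTop] fun n =>
      (n : ℝ) * Real.sqrt (rdsq n (R n)) * (r1sq n (R n) - (r0 n (R n)) ^ 2)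

/-- Condition (C4): `|Σ_{i≠j≠k} R_{ji} R_{ik} (R̄_{j·} − r0)(R̄_{k·} − r0)| =
o(n³ r_d² (r1² − r0²))`. -/
def Cond4 (R : (n : ℕ) → Fin n → Fin n → ℝ) : Prop :=
  (fun n =>
      |∑ i : Fin n, ∑ j : Fin n, ∑ k : Fin n,
        if i ≠ j ∧ i ≠ k ∧ j ≠ k then
          R n j i * R n i k * (Rbar n (R n) j - r0 n (R n)) * (Rbar n (R n) k - r0 n (R n))
        else 0|)
    =o[atTop] fun n => (n : ℝ) ^ 3 * rdsq n (R n) * (r1sq n (R n) - (r0 n (R n)) ^ 2)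

/-- Condition (C5): `Σ_i Σ_j Σ_{k∉{i,j}} Σ_{l∉{i,j}} R_{ij} R_{kl}
(R_{ik} R_{jl} + R_{il} R_{jk}) = o(n⁴ r_d⁴)`. -/
def Cond5 (R : (n : ℕ) → Fin n → Fin n → ℝ) : Prop :=
  (fun n =>
      ∑ i : Fin n, ∑ j : Fin n, ∑ k : Fin n, ∑ l : Fin n,
        if k ≠ i ∧ k ≠ j ∧ l ≠ i ∧ l ≠ j then
          R n i j * R n k l * (R n i k * R n j l + R n i l * R n j k)
        else 0)
    =o[atTop] fun n => (n : ℝ) ^ 4 * (rdsq n (R n)) ^ 2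

/-- Condition (C6): `r1 = o(r_d)`. -/
def Cond6 (R : (n : ℕ) → Fin n → Fin n → ℝ) : Prop :=
  (fun n => Real.sqrt (r1sq n (R n))) =o[atTop] fun n => Real.sqrt (rdsq n (R n))

end RING

open RING

set_option linter.unusedSectionVars false

namespace RING

section ProductExpectation

variable {ι L E : Type*} [Fintype ι] [DecidableEq ι] [Fintype L]
  [NormedAddCommGroup E] [NormedSpace ℝ E]

/-- Expectation of `f` on `ι → L` when the coordinates are independent with weights `p`. -/
noncomputable def prodExp (p : L → ℝ) (f : (ι → L) → E) : E :=
  ∑ ω : ι → L, (∏ i, p (ω i)) • f ω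

lemma prodExp_average {p : L → ℝ} (hp : ∑ b, p b = 1) (f : (ι → L) → E) (i : ι) :
    prodExp p (fun ω => ∑ b, p b • f (Function.update ω i b)) = prodExp p f := by
  have key : ∀ (ω : ι → L) (b : L),
      (∏ j, p (ω j)) * p b = (∏ j, p (Function.update ω i b j)) * p (ω i) := by
    intro ω b
    rw [← Finset.mul_prod_erase univ (fun j => p (ω j)) (mem_univ i),
      ← Finset.mul_prod_erase univ (fun j => p (Function.update ω i b j)) (mem_univ i)]
    have : ∏ j ∈ univ.erase i, p (Function.update ω i b j) = ∏ j ∈ univ.erase i, p (ω j) := by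
      refine Finset.prod_congr rfl fun j hj => ?_
      rw [Function.update_of_ne (Finset.ne_of_mem_erase hj)]
    rw [this]
    simp
    ring
  have inv : Function.Involutive
      (fun x : (ι → L) × L => (Function.update x.1 i x.2, x.1 i)) := by
    rintro ⟨ω, b⟩
    simp
  calc prodExp p (fun ω => ∑ b, p b • f (Function.update ω i b))
      = ∑ x : (ι → L) × L, ((∏ j, p (Function.update x.1 i x.2 j)) * p (x.1 i)) •
          f (Function.update x.1 i x.2) := by
        rw [Fintype.sum_prod_type]
        simp only [prodExp, Finset.smul_sum, smul_smul]
        exact Finset.sum_congr rfl fun ω _ => Finset.sum_congr rfl fun b _ => by rw [key ω b]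
    _ = ∑ x : (ι → L) × L, ((∏ j, p (x.1 j)) * p x.2) • f x.1 :=
        Fintype.sum_equiv (inv.toPerm _) _ _ fun x => rfl
    _ = prodExp p f := by
        rw [Fintype.sum_prod_type]
        simp only [prodExp, mul_smul, ← Finset.smul_sum, ← Finset.sum_smul, hp, one_smul]

lemma prodExp_eq_zero {p : L → ℝ} (hp : ∑ b, p b = 1) {f : (ι → L) → E} (i : ι)
    (h : ∀ ω, ∑ b, p b • f (Function.update ω i b) = 0) : prodExp p f = 0 := by
  rw [← prodExp_average hp f i]
  simp [prodExp, h]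

lemma sum_prod_weights {p : L → ℝ} (hp : ∑ b, p b = 1) : ∑ ω : ι → L, ∏ i, p (ω i) = 1 := by
  rw [← Fintype.prod_sum (fun (_ : ι) b => p b)]
  simp [hp]

lemma prodExp_const {p : L → ℝ} (hp : ∑ b, p b = 1) (c : E) :
    prodExp p (fun _ : ι → L => c) = c := by
  simp [prodExp, ← Finset.sum_smul, sum_prod_weights hp]

lemma prodExp_add (p : L → ℝ) (f g : (ι → L) → E) :
    prodExp p (fun ω => f ω + g ω) = prodExp p f + prodExp p g := by
  simp [prodExp, Finset.sum_add_distrib]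

lemma prodExp_sub (p : L → ℝ) (f g : (ι → L) → E) :
    prodExp p (fun ω => f ω - g ω) = prodExp p f - prodExp p g := by
  simp [prodExp, Finset.sum_sub_distrib, smul_sub]

lemma prodExp_sum (p : L → ℝ) {κ : Type*} (s : Finset κ) (f : κ → (ι → L) → E) :
    prodExp p (fun ω => ∑ k ∈ s, f k ω) = ∑ k ∈ s, prodExp p (f k) := by
  simp only [prodExp, Finset.smul_sum]
  exact Finset.sum_comm

lemma prodExp_const_mul {A : Type*} [NormedRing A] [NormedAlgebra ℝ A] (p : L → ℝ) (c : A)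
    (f : (ι → L) → A) : prodExp p (fun ω => c * f ω) = c * prodExp p f := by
  simp [prodExp, Finset.mul_sum]

lemma prodExp_mono {p : L → ℝ} (hp : ∀ b, 0 ≤ p b) {f g : (ι → L) → ℝ} (h : ∀ ω, f ω ≤ g ω) :
    prodExp p f ≤ prodExp p g :=
  Finset.sum_le_sum fun ω _ =>
    smul_le_smul_of_nonneg_left (h ω) (Finset.prod_nonneg fun _ _ => hp _)

lemma norm_prodExp_le {p : L → ℝ} (hp : ∀ b, 0 ≤ p b) (f : (ι → L) → E) :
    ‖prodExp p f‖ ≤ prodExp p (fun ω => ‖f ω‖) := by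
  refine (norm_sum_le _ _).trans (Finset.sum_le_sum fun ω _ => ?_)
  rw [norm_smul, Real.norm_of_nonneg (Finset.prod_nonneg fun i _ => hp _), smul_eq_mul]

lemma abs_prodExp_le {p : L → ℝ} (hp : ∀ b, 0 ≤ p b) (hp1 : ∑ b, p b = 1) {f : (ι → L) → ℝ}
    {K : ℝ} (h : ∀ ω, |f ω| ≤ K) : |prodExp p f| ≤ K := by
  refine (norm_prodExp_le hp f).trans ?_
  rw [← prodExp_const (ι := ι) hp1 K]
  exact prodExp_mono hp h

/-- A product of two functions has zero expectation if one factor averages to zero in a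
coordinate on which the other factor does not depend. -/
lemma prodExp_mul_eq_zero {p : L → ℝ} (hp : ∑ b, p b = 1) {A : Type*} [NormedRing A]
    [NormedAlgebra ℝ A] {f g : (ι → L) → A} (i : ι)
    (hf : ∀ ω, ∑ b, p b • f (Function.update ω i b) = 0)
    (hg : ∀ ω b, g (Function.update ω i b) = g ω) : prodExp p (fun ω => f ω * g ω) = 0 := by
  refine prodExp_eq_zero hp i fun ω => ?_
  simp only [hg, ← smul_mul_assoc, ← Finset.sum_mul, hf, zero_mul]

/-- Second moment bound for sums of completely degenerate functions of `r` coordinates. -/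
lemma prodExp_sq_sum_le {p : L → ℝ} (hp : ∀ b, 0 ≤ p b) (hp1 : ∑ b, p b = 1) {r : ℕ}
    (c : (Fin r → ι) → ℝ) (f : (Fin r → ι) → (ι → L) → ℝ) {K : ℝ}
    (hinj : ∀ α, c α ≠ 0 → Function.Injective α)
    (hdeg : ∀ α, c α ≠ 0 → ∀ q ω, ∑ b, p b * f α (Function.update ω (α q) b) = 0)
    (hdep : ∀ α β, c α ≠ 0 → c β ≠ 0 → ∀ q, α q ∉ Set.range β → ∀ ω b,
      f β (Function.update ω (α q) b) = f β ω)
    (hbd : ∀ α ω, |f α ω| ≤ K) :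
    prodExp p (fun ω => (∑ α, c α * f α ω) ^ 2) ≤ r.factorial * K ^ 2 * ∑ α, c α ^ 2 := by
  classical
  have hexp : prodExp p (fun ω => (∑ α, c α * f α ω) ^ 2)
      = ∑ α, ∑ β, c α * c β * prodExp p (fun ω => f α ω * f β ω) := by
    simp only [sq, Finset.sum_mul_sum, prodExp_sum, ← prodExp_const_mul]
    refine Finset.sum_congr rfl fun α _ => Finset.sum_congr rfl fun β _ => ?_
    congr 1
    ext ω
    ring
  have hK : ∀ α β, |prodExp p (fun ω => f α ω * f β ω)| ≤ K ^ 2 := by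
    intro α β
    refine abs_prodExp_le hp hp1 fun ω => ?_
    rw [abs_mul, sq]
    exact mul_le_mul (hbd α ω) (hbd β ω) (abs_nonneg _) ((abs_nonneg _).trans (hbd α ω))
  have hterm : ∀ α β, c α * c β * prodExp p (fun ω => f α ω * f β ω)
      ≤ ∑ σ : Equiv.Perm (Fin r), if β = α ∘ σ then K ^ 2 * ((c α ^ 2 + c β ^ 2) / 2) else 0 := by
    intro α β
    have hnn : ∀ σ ∈ (univ : Finset (Equiv.Perm (Fin r))),
        0 ≤ if β = α ∘ σ then K ^ 2 * ((c α ^ 2 + c β ^ 2) / 2) else 0 := by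
      intro σ _
      split_ifs <;> positivity
    by_cases h0 : c α = 0
    · simpa [h0] using Finset.sum_nonneg hnn
    by_cases h1 : c β = 0
    · simpa [h1] using Finset.sum_nonneg hnn
    by_cases hsub : ∀ q, α q ∈ Set.range β
    · choose τ hτ using hsub
      have hτi : Function.Injective τ := fun a b hab => hinj α h0 (by rw [← hτ a, ← hτ b, hab])
      let σ : Equiv.Perm (Fin r) := Equiv.ofBijective τ (Finite.injective_iff_bijective.mp hτi)
      have hσ : β = α ∘ σ.symm := by
        ext x
        have := hτ (σ.symm x)
        simp only [Function.comp_apply, ← this]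
        congr 1
        exact (σ.apply_symm_apply x).symm
      refine le_trans ?_ (Finset.single_le_sum hnn (mem_univ σ.symm))
      rw [if_pos hσ]
      calc c α * c β * prodExp p (fun ω => f α ω * f β ω)
          ≤ |c α * c β * prodExp p (fun ω => f α ω * f β ω)| := le_abs_self _
        _ = |c α * c β| * |prodExp p (fun ω => f α ω * f β ω)| := abs_mul _ _
        _ ≤ ((c α ^ 2 + c β ^ 2) / 2) * K ^ 2 := by
            refine mul_le_mul ?_ (hK α β) (abs_nonneg _) (by positivity)
            rw [abs_le]
            constructor <;> nlinarith [sq_nonneg (c α + c β), sq_nonneg (c α - c β)]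
        _ = _ := by ring
    · push Not at hsub
      obtain ⟨q, hq⟩ := hsub
      rw [prodExp_mul_eq_zero hp1 (α q) (by simpa using hdeg α h0 q) (hdep α β h0 h1 q hq), mul_zero]
      exact Finset.sum_nonneg hnn
  rw [hexp]
  calc ∑ α, ∑ β, c α * c β * prodExp p (fun ω => f α ω * f β ω)
      ≤ ∑ α, ∑ β, ∑ σ : Equiv.Perm (Fin r),
          if β = α ∘ σ then K ^ 2 * ((c α ^ 2 + c β ^ 2) / 2) else 0 :=
        Finset.sum_le_sum fun α _ => Finset.sum_le_sum fun β _ => hterm α β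
    _ = ∑ σ : Equiv.Perm (Fin r), ∑ α, K ^ 2 * ((c α ^ 2 + c (α ∘ σ) ^ 2) / 2) := by
        rw [Finset.sum_comm' (t' := univ) (s' := fun _ => univ) (by simp)]
        rw [Finset.sum_congr rfl fun β _ => Finset.sum_comm, Finset.sum_comm]
        refine Finset.sum_congr rfl fun σ _ => ?_
        rw [Finset.sum_comm]
        refine Finset.sum_congr rfl fun α _ => ?_
        rw [Finset.sum_ite_eq' univ (α ∘ σ)]
        simp
    _ = ∑ σ : Equiv.Perm (Fin r), K ^ 2 * ∑ α, c α ^ 2 := by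
        refine Finset.sum_congr rfl fun σ _ => ?_
        have : ∑ α : Fin r → ι, c (α ∘ σ) ^ 2 = ∑ α, c α ^ 2 :=
          Fintype.sum_equiv (Equiv.arrowCongr σ.symm (Equiv.refl ι)) _ _ fun α => by
            simp [Equiv.arrowCongr]
        rw [← Finset.mul_sum, ← Finset.sum_div, Finset.sum_add_distrib, this]
        ring
    _ = _ := by simp [Fintype.card_perm, mul_assoc]

end ProductExpectation

section QuadraticForm

variable {ι L : Type*} [Fintype ι] [DecidableEq ι] [Fintype L]

lemma sum_fin_one_fun (F : ι → ℝ) : ∑ α : Fin 1 → ι, F (α 0) = ∑ i, F i :=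
  Fintype.sum_equiv (Equiv.funUnique (Fin 1) ι) _ _ fun α => by simp

lemma sum_fin_two_fun (F : ι → ι → ℝ) :
    ∑ α : Fin 2 → ι, F (α 0) (α 1) = ∑ i, ∑ j, F i j := by
  rw [← Fintype.sum_prod_type']
  exact Fintype.sum_equiv (finTwoArrowEquiv ι) _ _ fun α => by simp

lemma sum_fin_three_fun (F : ι → ι → ι → ℝ) :
    ∑ α : Fin 3 → ι, F (α 0) (α 1) (α 2) = ∑ i, ∑ j, ∑ k, F i j k := by
  rw [← Fintype.sum_equiv (Fin.consEquiv fun _ : Fin 3 => ι)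
    (fun x : ι × (Fin 2 → ι) => F x.1 (x.2 0) (x.2 1)) _ (fun x => rfl), Fintype.sum_prod_type]
  exact Finset.sum_congr rfl fun i _ => sum_fin_two_fun (F i)

/-- The fourth power of the Schatten 4-norm, `tr((BᵀB)²)`. -/
def schattenFour (B : ι → ι → ℝ) : ℝ := ∑ j, ∑ k, (∑ i, B i j * B i k) ^ 2

/-- The row `i` contribution to the quadratic form with coefficients `B` and kernel `g`. -/
def rowForm (B : ι → ι → ℝ) (g : L → L → ℝ) (i : ι) (ω : ι → L) : ℝ :=
  ∑ j, B i j * g (ω i) (ω j)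

/-- The quadratic form `Σ B_{ij} g(ω_i, ω_j)`. -/
def quadForm (B : ι → ι → ℝ) (g : L → L → ℝ) (ω : ι → L) : ℝ := ∑ i, rowForm B g i ω

lemma sum_sq_row_le_schattenFour (B : ι → ι → ℝ) (hBs : ∀ i j, B i j = B j i) :
    ∑ i, (∑ j, B i j ^ 2) ^ 2 ≤ schattenFour B := by
  refine Finset.sum_le_sum fun i _ => ?_
  refine le_trans (le_of_eq ?_)
    (Finset.single_le_sum (f := fun k => (∑ l, B l i * B l k) ^ 2) (fun k _ => sq_nonneg _)
      (mem_univ i))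
  congr 1
  exact Finset.sum_congr rfl fun j _ => by rw [hBs i j, sq]

lemma rowForm_average {p : L → ℝ} {B : ι → ι → ℝ} {g : L → L → ℝ}
    (hg0 : ∀ c, ∑ b, p b * g b c = 0) (hBd : ∀ i, B i i = 0) (i : ι) (ω : ι → L) :
    ∑ b, p b * rowForm B g i (Function.update ω i b) = 0 := by
  simp only [rowForm, Finset.mul_sum]
  rw [Finset.sum_comm]
  refine Finset.sum_eq_zero fun j _ => ?_
  by_cases h : j = i
  · simp [h, hBd]
  · simp only [Function.update_self, Function.update_of_ne h]
    calc ∑ b, p b * (B i j * g b (ω j)) = B i j * ∑ b, p b * g b (ω j) := by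
          rw [Finset.mul_sum]; exact Finset.sum_congr rfl fun b _ => by ring
      _ = 0 := by rw [hg0, mul_zero]

lemma quadForm_sub_rowForm_update {B : ι → ι → ℝ} {g : L → L → ℝ} (hBs : ∀ i j, B i j = B j i)
    (hgs : ∀ b c, g b c = g c b) (hBd : ∀ i, B i i = 0) (i : ι) (ω : ι → L) (b : L) :
    quadForm B g (Function.update ω i b) - 2 * rowForm B g i (Function.update ω i b)
      = quadForm B g ω - 2 * rowForm B g i ω := by
  have key : ∀ ω : ι → L, quadForm B g ω - 2 * rowForm B g i ω
      = ∑ k, ∑ l, if k = i ∨ l = i then 0 else B k l * g (ω k) (ω l) := by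
    intro ω
    have h1 : rowForm B g i ω = ∑ k, ∑ l, if k = i then B k l * g (ω k) (ω l) else 0 := by
      rw [Finset.sum_comm]
      simp [rowForm]
    have h2 : rowForm B g i ω = ∑ k, ∑ l, if l = i then B k l * g (ω k) (ω l) else 0 := by
      simp only [rowForm, Finset.sum_ite_eq', mem_univ, if_true]
      exact Finset.sum_congr rfl fun k _ => by rw [hBs, hgs]
    rw [two_mul]
    nth_rw 1 [h1]
    rw [h2]
    simp only [quadForm, rowForm, ← Finset.sum_add_distrib, ← Finset.sum_sub_distrib]
    refine Finset.sum_congr rfl fun k _ => Finset.sum_congr rfl fun l _ => ?_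
    by_cases hk : k = i <;> by_cases hl : l = i <;> simp [hk, hl, hBd]
  rw [key, key]
  refine Finset.sum_congr rfl fun k _ => Finset.sum_congr rfl fun l _ => ?_
  by_cases hk : k = i <;> by_cases hl : l = i <;> simp [hk, hl]

lemma norm_exp_I_sub_one_sub_le (y : ℝ) :
    ‖Complex.exp (Complex.I * y) - 1 - Complex.I * y‖ ≤ 3 * y ^ 2 := by
  have hn : ‖Complex.I * (y : ℂ)‖ = |y| := by simp
  rcases le_or_gt |y| 1 with h | h
  · refine (Complex.norm_exp_sub_one_sub_id_le (by rw [hn]; exact h)).trans ?_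
    rw [hn, sq_abs]
    nlinarith [sq_nonneg y]
  · calc ‖Complex.exp (Complex.I * y) - 1 - Complex.I * y‖
        ≤ ‖Complex.exp (Complex.I * y)‖ + ‖(1 : ℂ)‖ + ‖Complex.I * (y : ℂ)‖ :=
          (norm_sub_le _ _).trans (add_le_add_left (norm_sub_le _ _) _)
      _ = 1 + 1 + |y| := by rw [Complex.norm_exp_I_mul_ofReal, hn, norm_one]
      _ ≤ 3 * y ^ 2 := by rw [← sq_abs]; nlinarith

/-- Stein's identity for a degenerate quadratic form, tested against `exp (i s ·)`. -/
lemma norm_stein_identity_le {p : L → ℝ} (hp : ∀ b, 0 ≤ p b) (hp1 : ∑ b, p b = 1)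
    {B : ι → ι → ℝ} {g : L → L → ℝ} (hBs : ∀ i j, B i j = B j i) (hBd : ∀ i, B i i = 0)
    (hgs : ∀ b c, g b c = g c b) (hg0 : ∀ c, ∑ b, p b * g b c = 0) (s : ℝ) :
    ‖prodExp p (fun ω => (quadForm B g ω : ℂ) * Complex.exp (Complex.I * ↑(s * quadForm B g ω)))
      - 2 * Complex.I * s * prodExp p (fun ω => ((∑ i, rowForm B g i ω ^ 2 : ℝ) : ℂ) *
          Complex.exp (Complex.I * ↑(s * quadForm B g ω)))‖
      ≤ 12 * s ^ 2 * prodExp p (fun ω => ∑ i, |rowForm B g i ω| ^ 3) := by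
  set T := quadForm B g
  set X := rowForm B g
  have h0 : ∀ i, prodExp p (fun ω => (X i ω : ℂ) *
      Complex.exp (Complex.I * ↑(s * (T ω - 2 * X i ω)))) = 0 := by
    intro i
    refine prodExp_mul_eq_zero hp1 i (fun ω => ?_) (fun ω b => ?_)
    · have := rowForm_average hg0 hBd i ω
      simp only [Complex.real_smul]
      exact_mod_cast this
    · simp only [T, X, quadForm_sub_rowForm_update hBs hgs hBd]
  have h1 : prodExp p (fun ω => (T ω : ℂ) * Complex.exp (Complex.I * ↑(s * T ω)))
      = prodExp p (fun ω => ∑ i, ((X i ω : ℂ) * Complex.exp (Complex.I * ↑(s * T ω)) -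
        (X i ω : ℂ) * Complex.exp (Complex.I * ↑(s * (T ω - 2 * X i ω))))) := by
    rw [prodExp_sum]
    simp only [prodExp_sub, h0, sub_zero]
    rw [← prodExp_sum]
    congr 1
    ext ω
    rw [← Finset.sum_mul]
    simp [T, X, quadForm]
  rw [h1, ← prodExp_const_mul, ← prodExp_sub, ← prodExp_const_mul]
  refine (norm_prodExp_le hp _).trans (prodExp_mono hp fun ω => ?_)
  have h2 : ∑ i, ((X i ω : ℂ) * Complex.exp (Complex.I * ↑(s * T ω)) -
        (X i ω : ℂ) * Complex.exp (Complex.I * ↑(s * (T ω - 2 * X i ω)))) -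
      2 * Complex.I * s * (((∑ i, X i ω ^ 2 : ℝ) : ℂ) * Complex.exp (Complex.I * ↑(s * T ω)))
      = ∑ i, -((X i ω : ℂ) * Complex.exp (Complex.I * ↑(s * T ω)) *
        (Complex.exp (Complex.I * ↑(-2 * s * X i ω)) - 1 - Complex.I * ↑(-2 * s * X i ω))) := by
    push_cast
    rw [Finset.sum_mul, Finset.mul_sum, ← Finset.sum_sub_distrib]
    refine Finset.sum_congr rfl fun i _ => ?_
    have : Complex.exp (Complex.I * (s * (T ω - 2 * X i ω)))
        = Complex.exp (Complex.I * (s * T ω)) * Complex.exp (Complex.I * (-2 * s * X i ω)) := by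
      rw [← Complex.exp_add]; congr 1; ring
    rw [this]
    ring
  rw [h2, Finset.mul_sum]
  refine (norm_sum_le _ _).trans (Finset.sum_le_sum fun i _ => ?_)
  rw [norm_neg, norm_mul, norm_mul, Complex.norm_exp_I_mul_ofReal, Complex.norm_real,
    Real.norm_eq_abs, mul_one]
  calc |X i ω| * ‖Complex.exp (Complex.I * ↑(-2 * s * X i ω)) - 1 - Complex.I * ↑(-2 * s * X i ω)‖
      ≤ |X i ω| * (3 * (-2 * s * X i ω) ^ 2) :=
        mul_le_mul_of_nonneg_left (norm_exp_I_sub_one_sub_le _) (abs_nonneg _)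
    _ = 12 * s ^ 2 * |X i ω| ^ 3 := by rw [mul_pow, ← sq_abs (X i ω)]; ring

end QuadraticForm

section QuadraticFormMoments

variable {ι L : Type*} [Fintype ι] [DecidableEq ι] [Fintype L]

lemma injective_fin_two {α : Fin 2 → ι} (h : α 0 ≠ α 1) : Function.Injective α := by
  intro a b hab
  fin_cases a <;> fin_cases b <;> simp_all

lemma injective_fin_three {α : Fin 3 → ι} (h : α 0 ≠ α 1) (h' : α 0 ≠ α 2) (h'' : α 1 ≠ α 2) :
    Function.Injective α := by
  intro a b hab
  fin_cases a <;> fin_cases b <;> simp_all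

lemma sum_mul_sum_eq_diag_add (F : ι → ι → ℝ) :
    ∑ j, ∑ k, F j k = ∑ j, F j j + ∑ j, ∑ k, if j ≠ k then F j k else 0 := by
  rw [← Finset.sum_add_distrib]
  refine Finset.sum_congr rfl fun j _ => ?_
  have : F j j = ∑ k, if j = k then F j k else 0 := by simp
  rw [this, ← Finset.sum_add_distrib]
  refine Finset.sum_congr rfl fun k _ => ?_
  by_cases h : j = k <;> simp [h]

lemma prodExp_rowForm_pow_four_le {p : L → ℝ} (hp : ∀ b, 0 ≤ p b) (hp1 : ∑ b, p b = 1)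
    {B : ι → ι → ℝ} {g : L → L → ℝ} {M : ℝ} (hBd : ∀ i, B i i = 0)
    (hgs : ∀ b c, g b c = g c b) (hg0 : ∀ c, ∑ b, p b * g b c = 0) (hgM : ∀ b c, |g b c| ≤ M)
    (i : ι) :
    prodExp p (fun ω => rowForm B g i ω ^ 4) ≤ 10 * M ^ 4 * (∑ j, B i j ^ 2) ^ 2 := by
  set c : (Fin 2 → ι) → ℝ := fun α => if α 0 ≠ α 1 then B i (α 0) * B i (α 1) else 0 with hc
  set f : (Fin 2 → ι) → (ι → L) → ℝ := fun α ω => g (ω i) (ω (α 0)) * g (ω i) (ω (α 1)) with hf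
  have hc0 : ∀ α, c α ≠ 0 → α 0 ≠ α 1 ∧ α 0 ≠ i ∧ α 1 ≠ i := by
    intro α h
    refine ⟨fun h' => h (by simp [hc, h']), fun h' => h ?_, fun h' => h ?_⟩ <;>
      simp [hc, h', hBd]
  have hsplit : ∀ ω, rowForm B g i ω ^ 2
      = ∑ j, B i j ^ 2 * g (ω i) (ω j) ^ 2 + ∑ α, c α * f α ω := by
    intro ω
    have h2 := sum_fin_two_fun (fun j k => (if j ≠ k then B i j * B i k else 0) *
      (g (ω i) (ω j) * g (ω i) (ω k)))
    simp only [hc, hf]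
    rw [h2, sq, rowForm, Finset.sum_mul_sum, sum_mul_sum_eq_diag_add]
    congr 1
    · exact Finset.sum_congr rfl fun j _ => by ring
    · refine Finset.sum_congr rfl fun j _ => Finset.sum_congr rfl fun k _ => ?_
      split_ifs <;> ring
  have hM : ∀ b c, g b c ^ 2 ≤ M ^ 2 := fun b c => by
    rw [← sq_abs]; exact pow_le_pow_left₀ (abs_nonneg _) (hgM b c) 2
  have hdiag : ∀ ω : ι → L, (∑ j, B i j ^ 2 * g (ω i) (ω j) ^ 2) ^ 2
      ≤ M ^ 4 * (∑ j, B i j ^ 2) ^ 2 := by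
    intro ω
    have : ∑ j, B i j ^ 2 * g (ω i) (ω j) ^ 2 ≤ M ^ 2 * ∑ j, B i j ^ 2 := by
      rw [Finset.mul_sum]
      exact Finset.sum_le_sum fun j _ => by nlinarith [hM (ω i) (ω j), sq_nonneg (B i j)]
    calc _ ≤ (M ^ 2 * ∑ j, B i j ^ 2) ^ 2 :=
          pow_le_pow_left₀ (Finset.sum_nonneg fun j _ => by positivity) this 2
      _ = _ := by ring
  have hoff : prodExp p (fun ω => (∑ α, c α * f α ω) ^ 2)
      ≤ Nat.factorial 2 * (M ^ 2) ^ 2 * ∑ α, c α ^ 2 := by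
    refine prodExp_sq_sum_le hp hp1 c f (K := M ^ 2) (fun α h => injective_fin_two (hc0 α h).1) ?_ ?_ ?_
    · intro α h q ω
      obtain ⟨h1, h2, h3⟩ := hc0 α h
      fin_cases q
      · simp only [hf, Fin.zero_eta, Function.update_self, Function.update_of_ne h2.symm,
          Function.update_of_ne h1.symm]
        simp only [hgs (ω i), ← mul_assoc, ← Finset.sum_mul, hg0, zero_mul]
      · simp only [hf, Fin.mk_one, Function.update_self, Function.update_of_ne h3.symm,
          Function.update_of_ne h1]
        simp only [hgs (ω i), mul_comm (g (ω (α 0)) (ω i)), ← mul_assoc, ← Finset.sum_mul, hg0,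
          zero_mul]
    · intro α β h h' q hq ω b
      obtain ⟨h1, h2, h3⟩ := hc0 α h
      have hi : i ≠ α q := by fin_cases q; exacts [h2.symm, h3.symm]
      have hβ : ∀ r, β r ≠ α q := fun r hr => hq ⟨r, hr⟩
      simp only [hf, Function.update_of_ne hi, Function.update_of_ne (hβ _)]
    · intro α ω
      rw [hf, abs_mul, sq]
      exact mul_le_mul (hgM _ _) (hgM _ _) (abs_nonneg _) ((abs_nonneg _).trans (hgM (ω i) (ω i)))
  have hcs : ∑ α, c α ^ 2 ≤ (∑ j, B i j ^ 2) ^ 2 := by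
    have h2 := sum_fin_two_fun (fun j k => (if j ≠ k then B i j * B i k else 0) ^ 2)
    simp only [hc]
    rw [h2, sq (∑ j, B i j ^ 2), Finset.sum_mul_sum]
    refine Finset.sum_le_sum fun j _ => Finset.sum_le_sum fun k _ => ?_
    split_ifs
    · rw [mul_pow]
    · rw [zero_pow two_ne_zero]; positivity
  calc prodExp p (fun ω => rowForm B g i ω ^ 4)
      ≤ prodExp p (fun ω => 2 * (M ^ 4 * (∑ j, B i j ^ 2) ^ 2) + 2 * (∑ α, c α * f α ω) ^ 2) := by
        refine prodExp_mono hp fun ω => ?_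
        have : rowForm B g i ω ^ 4 = (rowForm B g i ω ^ 2) ^ 2 := by ring
        rw [this, hsplit]
        nlinarith [hdiag ω, sq_nonneg (∑ j, B i j ^ 2 * g (ω i) (ω j) ^ 2 - ∑ α, c α * f α ω)]
    _ = 2 * (M ^ 4 * (∑ j, B i j ^ 2) ^ 2) + 2 * prodExp p (fun ω => (∑ α, c α * f α ω) ^ 2) := by
        rw [prodExp_add, prodExp_const hp1, prodExp_const_mul]
    _ ≤ _ := by
        have hM4 : 0 ≤ M ^ 4 := by positivity
        have e : (Nat.factorial 2 : ℝ) * (M ^ 2) ^ 2 = 2 * M ^ 4 := by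
          simp [Nat.factorial]; ring
        rw [e] at hoff
        nlinarith [mul_le_mul_of_nonneg_left hcs hM4, mul_nonneg hM4 (sq_nonneg (∑ j, B i j ^ 2))]

/-- Concentration of the sum of squares of the row contributions. -/
lemma prodExp_sum_rowForm_sq_sub_le {p : L → ℝ} (hp : ∀ b, 0 ≤ p b) (hp1 : ∑ b, p b = 1)
    {B : ι → ι → ℝ} {g : L → L → ℝ} {M : ℝ} (hBs : ∀ i j, B i j = B j i)
    (hBd : ∀ i, B i i = 0) (hB1 : ∑ i, ∑ j, B i j ^ 2 = 1)
    (hgs : ∀ b c, g b c = g c b) (hg0 : ∀ c, ∑ b, p b * g b c = 0) (hgM : ∀ b c, |g b c| ≤ M) :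
    prodExp p (fun ω => (∑ i, rowForm B g i ω ^ 2 - ∑ b, ∑ c, p b * p c * g b c ^ 2) ^ 2)
      ≤ 400 * M ^ 4 * schattenFour B := by
  set μ := ∑ b, ∑ c, p b * p c * g b c ^ 2 with hμ
  set r : L → ℝ := fun b => ∑ c, p c * g b c ^ 2 with hr
  set G : L → L → ℝ := fun b c => ∑ a, p a * (g a b * g a c) with hG
  set ρ : ι → ℝ := fun i => ∑ j, B i j ^ 2 with hρ
  set D : ι → ι → ℝ := fun j k => ∑ i, B i j * B i k with hD
  have hM0 : ∀ b c : L, 0 ≤ M := fun b c => (abs_nonneg _).trans (hgM b c)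
  have hM : ∀ b c, g b c ^ 2 ≤ M ^ 2 := fun b c => by
    rw [← sq_abs]; exact pow_le_pow_left₀ (abs_nonneg _) (hgM b c) 2
  have avg_le : ∀ (h : L → ℝ) (K : ℝ), (∀ b, |h b| ≤ K) → |∑ b, p b * h b| ≤ K := by
    intro h K hK
    calc |∑ b, p b * h b| ≤ ∑ b, |p b * h b| := Finset.abs_sum_le_sum_abs _ _
      _ ≤ ∑ b, p b * K := Finset.sum_le_sum fun b _ => by
          rw [abs_mul, abs_of_nonneg (hp b)]; exact mul_le_mul_of_nonneg_left (hK b) (hp b)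
      _ = K := by rw [← Finset.sum_mul, hp1, one_mul]
  have hgsq : ∀ b c, |g b c ^ 2| ≤ M ^ 2 := fun b c => by
    rw [abs_of_nonneg (sq_nonneg _)]; exact hM b c
  have hrM : ∀ b, |r b| ≤ M ^ 2 := fun b => avg_le _ _ fun c => hgsq b c
  have hμr : μ = ∑ b, p b * r b := by
    simp only [hμ, hr, Finset.mul_sum, mul_assoc]
  have hμM : |μ| ≤ M ^ 2 := by rw [hμr]; exact avg_le _ _ hrM
  have hGM : ∀ b c, |G b c| ≤ M ^ 2 := fun b c => avg_le _ _ fun a => by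
    rw [abs_mul, sq]
    exact mul_le_mul (hgM _ _) (hgM _ _) (abs_nonneg _) (hM0 b c)
  have hG0 : ∀ c, ∑ b, p b * G b c = 0 := by
    intro c
    simp only [hG, Finset.mul_sum]
    rw [Finset.sum_comm]
    refine Finset.sum_eq_zero fun a _ => ?_
    calc ∑ b, p b * (p a * (g a b * g a c)) = p a * g a c * ∑ b, p b * g b a := by
          rw [Finset.mul_sum]; exact Finset.sum_congr rfl fun b _ => by rw [hgs b a]; ring
      _ = 0 := by rw [hg0, mul_zero]
  have hGs : ∀ b c, G b c = G c b := fun b c =>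
    Finset.sum_congr rfl fun a _ => by rw [mul_comm (g a b)]
  -- the four degenerate components
  set c1 : (Fin 1 → ι) → ℝ := fun α => 2 * ρ (α 0) with hc1
  set f1 : (Fin 1 → ι) → (ι → L) → ℝ := fun α ω => r (ω (α 0)) - μ with hf1
  set c2 : (Fin 2 → ι) → ℝ := fun α => B (α 0) (α 1) ^ 2 with hc2
  set f2 : (Fin 2 → ι) → (ι → L) → ℝ := fun α ω =>
    g (ω (α 0)) (ω (α 1)) ^ 2 - r (ω (α 0)) - r (ω (α 1)) + μ with hf2
  set c3 : (Fin 2 → ι) → ℝ := fun α => if α 0 ≠ α 1 then D (α 0) (α 1) else 0 with hc3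
  set f3 : (Fin 2 → ι) → (ι → L) → ℝ := fun α ω => G (ω (α 0)) (ω (α 1)) with hf3
  set c4 : (Fin 3 → ι) → ℝ := fun α =>
    if α 1 ≠ α 2 then B (α 0) (α 1) * B (α 0) (α 2) else 0 with hc4
  set f4 : (Fin 3 → ι) → (ι → L) → ℝ := fun α ω =>
    g (ω (α 0)) (ω (α 1)) * g (ω (α 0)) (ω (α 2)) - G (ω (α 1)) (ω (α 2)) with hf4
  have hρs : ∑ i, ρ i ^ 2 ≤ schattenFour B := sum_sq_row_le_schattenFour B hBs
  have hM40 : 0 ≤ M ^ 4 := by positivity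
  have b1 : prodExp p (fun ω => (∑ α, c1 α * f1 α ω) ^ 2) ≤ 16 * M ^ 4 * schattenFour B := by
    refine (prodExp_sq_sum_le hp hp1 c1 f1 (K := 2 * M ^ 2)
      (fun α _ => Function.injective_of_subsingleton α) ?_ ?_ ?_).trans ?_
    · intro α _ q ω
      have : q = 0 := Subsingleton.elim _ _
      subst this
      simp only [hf1, Function.update_self, mul_sub, Finset.sum_sub_distrib, ← Finset.sum_mul, hp1,
        ← hμr]
      ring
    · intro α β _ _ q hq ω b
      have hβ : ∀ r, β r ≠ α q := fun r hr => hq ⟨r, hr⟩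
      simp only [hf1, Function.update_of_ne (hβ _)]
    · intro α ω
      refine (abs_sub _ _).trans ?_
      linarith [hrM (ω (α 0))]
    · have h := sum_fin_one_fun (fun i => (2 * ρ i) ^ 2)
      simp only [hc1]
      rw [h]
      simp only [mul_pow, ← Finset.mul_sum]
      simp only [Nat.factorial]
      push_cast
      nlinarith [mul_le_mul_of_nonneg_left hρs hM40]
  have b2 : prodExp p (fun ω => (∑ α, c2 α * f2 α ω) ^ 2) ≤ 32 * M ^ 4 * schattenFour B := by
    have hne : ∀ α, c2 α ≠ 0 → α 0 ≠ α 1 := fun α h h' => h (by simp [hc2, h', hBd])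
    refine (prodExp_sq_sum_le hp hp1 c2 f2 (K := 4 * M ^ 2)
      (fun α h => injective_fin_two (hne α h)) ?_ ?_ ?_).trans ?_
    · intro α h q ω
      have h1 := hne α h
      fin_cases q
      · simp only [hf2, Fin.zero_eta, Function.update_self, Function.update_of_ne h1.symm, mul_sub,
          mul_add, Finset.sum_sub_distrib, Finset.sum_add_distrib, ← Finset.sum_mul, hp1, ← hμr,
          hgs _ (ω (α 1))]
        simp only [hr]
        ring
      · simp only [hf2, Fin.mk_one, Function.update_self, Function.update_of_ne h1, mul_sub,
          mul_add, Finset.sum_sub_distrib, Finset.sum_add_distrib, ← Finset.sum_mul, hp1, ← hμr]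
        simp only [hr]
        ring
    · intro α β _ _ q hq ω b
      have hβ : ∀ r, β r ≠ α q := fun r hr => hq ⟨r, hr⟩
      simp only [hf2, Function.update_of_ne (hβ _)]
    · intro α ω
      have h1 := abs_le.mp (hgsq (ω (α 0)) (ω (α 1)))
      have h2 := abs_le.mp (hrM (ω (α 0)))
      have h3 := abs_le.mp (hrM (ω (α 1)))
      have h4 := abs_le.mp hμM
      rw [abs_le]
      constructor <;> simp only [hf2] <;> linarith [h1.1, h1.2, h2.1, h2.2]
    · have h := sum_fin_two_fun (fun i j => (B i j ^ 2) ^ 2)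
      simp only [hc2]
      rw [h]
      have h' : ∑ i, ∑ j, (B i j ^ 2) ^ 2 ≤ ∑ i, ρ i ^ 2 := Finset.sum_le_sum fun i _ => by
        have := Finset.sum_sq_le_sq_sum_of_nonneg (s := univ) (f := fun j => B i j ^ 2)
          (fun j _ => sq_nonneg _)
        simpa using this
      simp only [Nat.factorial]
      push_cast
      nlinarith [mul_le_mul_of_nonneg_left (h'.trans hρs) hM40]
  have b3 : prodExp p (fun ω => (∑ α, c3 α * f3 α ω) ^ 2) ≤ 2 * M ^ 4 * schattenFour B := by
    have hne : ∀ α, c3 α ≠ 0 → α 0 ≠ α 1 := fun α h h' => h (by simp [hc3, h'])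
    refine (prodExp_sq_sum_le hp hp1 c3 f3 (K := M ^ 2)
      (fun α h => injective_fin_two (hne α h)) ?_ ?_ (fun α ω => hGM _ _)).trans ?_
    · intro α h q ω
      have h1 := hne α h
      fin_cases q
      · simp only [hf3, Fin.zero_eta, Function.update_self, Function.update_of_ne h1.symm, hG0]
      · simp only [hf3, Fin.mk_one, Function.update_self, Function.update_of_ne h1,
          hGs (ω (α 0)), hG0]
    · intro α β _ _ q hq ω b
      have hβ : ∀ r, β r ≠ α q := fun r hr => hq ⟨r, hr⟩
      simp only [hf3, Function.update_of_ne (hβ _)]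
    · have h := sum_fin_two_fun (fun j k => (if j ≠ k then D j k else 0) ^ 2)
      simp only [hc3]
      rw [h]
      have h' : ∑ j, ∑ k, (if j ≠ k then D j k else 0) ^ 2 ≤ schattenFour B :=
        Finset.sum_le_sum fun j _ => Finset.sum_le_sum fun k _ => by
          split_ifs
          · exact le_rfl
          · rw [zero_pow two_ne_zero]; positivity
      simp only [Nat.factorial]
      push_cast
      nlinarith [mul_le_mul_of_nonneg_left h' hM40]
  have b4 : prodExp p (fun ω => (∑ α, c4 α * f4 α ω) ^ 2) ≤ 24 * M ^ 4 * schattenFour B := by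
    have hne : ∀ α, c4 α ≠ 0 → α 0 ≠ α 1 ∧ α 0 ≠ α 2 ∧ α 1 ≠ α 2 := by
      intro α h
      refine ⟨fun h' => h ?_, fun h' => h ?_, fun h' => h (by simp [hc4, h'])⟩ <;>
      · simp only [hc4, h', hBd]
        simp
    refine (prodExp_sq_sum_le hp hp1 c4 f4 (K := 2 * M ^ 2)
      (fun α h => injective_fin_three (hne α h).1 (hne α h).2.1 (hne α h).2.2) ?_ ?_ ?_).trans ?_
    · intro α h q ω
      obtain ⟨h01, h02, h12⟩ := hne α h
      fin_cases q
      · simp only [hf4, Fin.zero_eta, Function.update_self, Function.update_of_ne h01.symm,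
          Function.update_of_ne h02.symm, mul_sub, Finset.sum_sub_distrib, ← Finset.sum_mul, hp1]
        simp only [hG]
        ring
      · simp only [hf4, Fin.mk_one, Function.update_self, Function.update_of_ne h01,
          Function.update_of_ne h12.symm, mul_sub, Finset.sum_sub_distrib, hG0, hgs (ω (α 0)),
          ← mul_assoc, ← Finset.sum_mul, hg0]
        simp
      · simp only [hf4, Fin.reduceFinMk, Function.update_self, Function.update_of_ne h02,
          Function.update_of_ne h12, mul_sub, Finset.sum_sub_distrib, hGs (ω (α 1)), hG0,
          hgs (ω (α 0)), mul_comm (g (ω (α 1)) (ω (α 0))),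
          ← mul_assoc, ← Finset.sum_mul, hg0]
        simp
    · intro α β _ _ q hq ω b
      have hβ : ∀ r, β r ≠ α q := fun r hr => hq ⟨r, hr⟩
      simp only [hf4, Function.update_of_ne (hβ _)]
    · intro α ω
      refine (abs_sub _ _).trans ?_
      have : |g (ω (α 0)) (ω (α 1)) * g (ω (α 0)) (ω (α 2))| ≤ M ^ 2 := by
        rw [abs_mul, sq]
        exact mul_le_mul (hgM _ _) (hgM _ _) (abs_nonneg _) ((abs_nonneg _).trans (hgM (ω (α 0)) (ω (α 1))))
      linarith [hGM (ω (α 1)) (ω (α 2))]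
    · have h := sum_fin_three_fun (fun i j k => (if j ≠ k then B i j * B i k else 0) ^ 2)
      simp only [hc4]
      rw [h]
      have h' : ∑ i, ∑ j, ∑ k, (if j ≠ k then B i j * B i k else 0) ^ 2 ≤ ∑ i, ρ i ^ 2 :=
        Finset.sum_le_sum fun i _ => by
          rw [hρ, sq (∑ j, B i j ^ 2), Finset.sum_mul_sum]
          refine Finset.sum_le_sum fun j _ => Finset.sum_le_sum fun k _ => ?_
          split_ifs
          · rw [mul_pow]
          · rw [zero_pow two_ne_zero]; positivity
      simp only [Nat.factorial]
      push_cast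
      nlinarith [mul_le_mul_of_nonneg_left (h'.trans hρs) hM40]
  have hdecomp : ∀ ω, ∑ i, rowForm B g i ω ^ 2 - μ
      = ∑ α, c1 α * f1 α ω + ∑ α, c2 α * f2 α ω + ∑ α, c3 α * f3 α ω + ∑ α, c4 α * f4 α ω := by
    intro ω
    have e1 := sum_fin_one_fun (fun i => (2 * ρ i) * (r (ω i) - μ))
    have e2 := sum_fin_two_fun (fun i j => B i j ^ 2 *
      (g (ω i) (ω j) ^ 2 - r (ω i) - r (ω j) + μ))
    have e3 := sum_fin_two_fun (fun j k => (if j ≠ k then D j k else 0) * G (ω j) (ω k))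
    have e4 := sum_fin_three_fun (fun i j k => (if j ≠ k then B i j * B i k else 0) *
      (g (ω i) (ω j) * g (ω i) (ω k) - G (ω j) (ω k)))
    simp only [hc1, hc2, hc3, hc4, hf1, hf2, hf3, hf4]
    rw [e1, e2, e3, e4]
    have d1 : ∑ i, rowForm B g i ω ^ 2 = ∑ i, ∑ j, B i j ^ 2 * g (ω i) (ω j) ^ 2
        + ∑ i, ∑ j, ∑ k, if j ≠ k then B i j * B i k * (g (ω i) (ω j) * g (ω i) (ω k)) else 0 := by
      rw [← Finset.sum_add_distrib]
      refine Finset.sum_congr rfl fun i _ => ?_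
      rw [sq, rowForm, Finset.sum_mul_sum, sum_mul_sum_eq_diag_add]
      congr 1
      · exact Finset.sum_congr rfl fun j _ => by ring
      · refine Finset.sum_congr rfl fun j _ => Finset.sum_congr rfl fun k _ => ?_
        split_ifs <;> ring
    have d2 : ∑ i, ∑ j, B i j ^ 2 * r (ω j) = ∑ i, ρ i * r (ω i) := by
      rw [Finset.sum_comm]
      simp only [hρ, Finset.sum_mul]
      exact Finset.sum_congr rfl fun i _ => Finset.sum_congr rfl fun j _ => by rw [hBs]
    have d3 : ∑ i, ∑ j, B i j ^ 2 * r (ω i) = ∑ i, ρ i * r (ω i) := by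
      simp only [hρ, Finset.sum_mul]
    have d4 : ∑ j, ∑ k, (if j ≠ k then D j k else 0) * G (ω j) (ω k)
        = ∑ i, ∑ j, ∑ k, (if j ≠ k then B i j * B i k else 0) * G (ω j) (ω k) := by
      rw [Finset.sum_comm' (s := univ) (t := fun _ => univ) (t' := univ) (s' := fun _ => univ)
        (by simp)]
      symm
      rw [Finset.sum_comm]
      rw [Finset.sum_congr rfl fun j _ => Finset.sum_comm]
      rw [Finset.sum_comm]
      refine Finset.sum_congr rfl fun k _ => Finset.sum_congr rfl fun j _ => ?_
      split_ifs
      · rw [← Finset.sum_mul]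
      · simp
    have d5 : ∑ i, ∑ j, B i j ^ 2 * (g (ω i) (ω j) ^ 2 - r (ω i) - r (ω j) + μ)
        = ∑ i, ∑ j, B i j ^ 2 * g (ω i) (ω j) ^ 2 - ∑ i, ∑ j, B i j ^ 2 * r (ω i)
          - ∑ i, ∑ j, B i j ^ 2 * r (ω j) + (∑ i, ρ i) * μ := by
      simp only [hρ, mul_sub, mul_add, Finset.sum_sub_distrib, Finset.sum_add_distrib,
        Finset.sum_mul]
    have d6 : ∑ i, 2 * ρ i * (r (ω i) - μ) = 2 * ∑ i, ρ i * r (ω i) - 2 * (∑ i, ρ i) * μ := by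
      rw [mul_assoc, Finset.sum_mul, Finset.mul_sum, Finset.mul_sum, ← Finset.sum_sub_distrib]
      exact Finset.sum_congr rfl fun i _ => by ring
    have d7 : ∑ i, ∑ j, ∑ k, (if j ≠ k then B i j * B i k else 0) *
          (g (ω i) (ω j) * g (ω i) (ω k) - G (ω j) (ω k))
        = ∑ i, ∑ j, ∑ k, (if j ≠ k then B i j * B i k * (g (ω i) (ω j) * g (ω i) (ω k)) else 0)
          - ∑ i, ∑ j, ∑ k, (if j ≠ k then B i j * B i k else 0) * G (ω j) (ω k) := by
      simp only [← Finset.sum_sub_distrib]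
      refine Finset.sum_congr rfl fun i _ => Finset.sum_congr rfl fun j _ =>
        Finset.sum_congr rfl fun k _ => ?_
      split_ifs <;> ring
    have hρ1 : ∑ i, ρ i = 1 := hB1
    rw [d1, d4, d5, d6, d7, d2, d3, hρ1]
    ring
  calc prodExp p (fun ω => (∑ i, rowForm B g i ω ^ 2 - μ) ^ 2)
      ≤ prodExp p (fun ω => 4 * ((∑ α, c1 α * f1 α ω) ^ 2 + (∑ α, c2 α * f2 α ω) ^ 2
          + (∑ α, c3 α * f3 α ω) ^ 2 + (∑ α, c4 α * f4 α ω) ^ 2)) := by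
        refine prodExp_mono hp fun ω => ?_
        rw [hdecomp]
        generalize ∑ α, c1 α * f1 α ω = x
        generalize ∑ α, c2 α * f2 α ω = y
        generalize ∑ α, c3 α * f3 α ω = z
        generalize ∑ α, c4 α * f4 α ω = w
        nlinarith [sq_nonneg (x - y), sq_nonneg (x - z), sq_nonneg (x - w), sq_nonneg (y - z),
          sq_nonneg (y - w), sq_nonneg (z - w)]
    _ ≤ 400 * M ^ 4 * schattenFour B := by
        have hS : 0 ≤ M ^ 4 * schattenFour B := mul_nonneg hM40
          (Finset.sum_nonneg fun j _ => Finset.sum_nonneg fun k _ => sq_nonneg _)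
        rw [prodExp_const_mul, prodExp_add, prodExp_add, prodExp_add]
        nlinarith

end QuadraticFormMoments

section QuadraticFormCLT

variable {ι L : Type*} [Fintype ι] [DecidableEq ι] [Fintype L]

lemma prodExp_abs_le {p : L → ℝ} (hp : ∀ b, 0 ≤ p b) (hp1 : ∑ b, p b = 1) {f : (ι → L) → ℝ}
    {c : ℝ} (hc : 0 ≤ c) (h : prodExp p (fun ω => f ω ^ 2) ≤ c ^ 2) :
    prodExp p (fun ω => |f ω|) ≤ c := by
  set m := prodExp p (fun ω => |f ω|) with hm
  have h0 : 0 ≤ prodExp p (fun ω => (|f ω| - m) ^ 2) := by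
    rw [← prodExp_const (ι := ι) hp1 (0 : ℝ)]
    exact prodExp_mono hp fun ω => sq_nonneg _
  have h1 : prodExp p (fun ω => (|f ω| - m) ^ 2) = prodExp p (fun ω => f ω ^ 2) - m ^ 2 := by
    have : (fun ω => (|f ω| - m) ^ 2) = fun ω => (f ω ^ 2 - 2 * m * |f ω|) + m ^ 2 := by
      ext ω
      rw [← sq_abs (f ω)]
      ring
    rw [this, prodExp_add, prodExp_sub, prodExp_const_mul, prodExp_const hp1, ← hm]
    ring
  exact abs_le_of_sq_le_sq' (by linarith) hc |>.2

lemma prodExp_sum_abs_rowForm_cube_le {p : L → ℝ} (hp : ∀ b, 0 ≤ p b) (hp1 : ∑ b, p b = 1)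
    {B : ι → ι → ℝ} {g : L → L → ℝ} {M δ : ℝ} (hBs : ∀ i j, B i j = B j i)
    (hBd : ∀ i, B i i = 0) (hB1 : ∑ i, ∑ j, B i j ^ 2 = 1)
    (hgs : ∀ b c, g b c = g c b) (hg0 : ∀ c, ∑ b, p b * g b c = 0) (hgM : ∀ b c, |g b c| ≤ M)
    (hδ : 0 < δ) (hQ : schattenFour B ≤ δ ^ 2) :
    prodExp p (fun ω => ∑ i, |rowForm B g i ω| ^ 3) ≤ (2 * M ^ 2 + 5 * M ^ 4) * δ := by
  have h4 := prodExp_rowForm_pow_four_le hp hp1 hBd hgs hg0 hgM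
  have h2 : ∀ i, prodExp p (fun ω => rowForm B g i ω ^ 2) ≤ 4 * M ^ 2 * ∑ j, B i j ^ 2 := by
    intro i
    have h0 : 0 ≤ ∑ j, B i j ^ 2 := Finset.sum_nonneg fun j _ => sq_nonneg _
    have := prodExp_abs_le hp hp1 (f := fun ω => rowForm B g i ω ^ 2)
      (c := 4 * M ^ 2 * ∑ j, B i j ^ 2) (by positivity) (by
        have e : (fun ω => (rowForm B g i ω ^ 2) ^ 2) = fun ω => rowForm B g i ω ^ 4 := by
          ext ω; ring
        rw [e]
        refine (h4 i).trans ?_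
        have : 0 ≤ M ^ 4 * (∑ j, B i j ^ 2) ^ 2 := by positivity
        nlinarith)
    simpa only [abs_sq] using this
  have hpt : ∀ x : ℝ, |x| ^ 3 ≤ δ / 2 * x ^ 2 + 1 / (2 * δ) * x ^ 4 := by
    intro x
    have e : δ / 2 * x ^ 2 + 1 / (2 * δ) * x ^ 4 - |x| ^ 3
        = x ^ 2 * (δ - |x|) ^ 2 / (2 * δ) := by
      have h1 : x ^ 4 = |x| ^ 4 := by rw [pow_abs, abs_of_nonneg (by positivity)]
      rw [h1, ← sq_abs x]
      field_simp
      ring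
    have : 0 ≤ x ^ 2 * (δ - |x|) ^ 2 / (2 * δ) := by positivity
    linarith
  calc prodExp p (fun ω => ∑ i, |rowForm B g i ω| ^ 3)
      ≤ prodExp p (fun ω => ∑ i, (δ / 2 * rowForm B g i ω ^ 2
          + 1 / (2 * δ) * rowForm B g i ω ^ 4)) :=
        prodExp_mono hp fun ω => Finset.sum_le_sum fun i _ => hpt _
    _ = δ / 2 * ∑ i, prodExp p (fun ω => rowForm B g i ω ^ 2)
          + 1 / (2 * δ) * ∑ i, prodExp p (fun ω => rowForm B g i ω ^ 4) := by
        rw [prodExp_sum]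
        simp only [prodExp_add, prodExp_const_mul, Finset.sum_add_distrib, Finset.mul_sum]
    _ ≤ δ / 2 * (4 * M ^ 2) + 1 / (2 * δ) * (10 * M ^ 4 * δ ^ 2) := by
        refine add_le_add (mul_le_mul_of_nonneg_left ?_ (by positivity))
          (mul_le_mul_of_nonneg_left ?_ (by positivity))
        · refine (Finset.sum_le_sum fun i _ => h2 i).trans ?_
          rw [← Finset.mul_sum, hB1, mul_one]
        · refine (Finset.sum_le_sum fun i _ => h4 i).trans ?_
          rw [← Finset.mul_sum]
          exact mul_le_mul_of_nonneg_left ((sum_sq_row_le_schattenFour B hBs).trans hQ)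
            (by positivity)
    _ = _ := by field_simp; ring

/-- Quantitative central limit theorem for a degenerate quadratic form in independent
variables, at the level of characteristic functions. -/
lemma norm_prodExp_exp_quadForm_sub_le {p : L → ℝ} (hp : ∀ b, 0 ≤ p b) (hp1 : ∑ b, p b = 1)
    {B : ι → ι → ℝ} {g : L → L → ℝ} {M δ : ℝ} (hBs : ∀ i j, B i j = B j i)
    (hBd : ∀ i, B i i = 0) (hB1 : ∑ i, ∑ j, B i j ^ 2 = 1)
    (hgs : ∀ b c, g b c = g c b) (hg0 : ∀ c, ∑ b, p b * g b c = 0) (hgM : ∀ b c, |g b c| ≤ M)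
    (hδ : 0 < δ) (hQ : schattenFour B ≤ δ ^ 2) (s : ℝ) :
    ‖prodExp p (fun ω => Complex.exp (Complex.I * ↑(s * quadForm B g ω)))
        - Complex.exp (-(s ^ 2 * ∑ b, ∑ c, p b * p c * g b c ^ 2 : ℝ))‖
      ≤ (40 * M ^ 2 * s ^ 2 + 12 * |s| ^ 3 * (2 * M ^ 2 + 5 * M ^ 4)) * δ := by
  set μ := ∑ b, ∑ c, p b * p c * g b c ^ 2 with hμ
  have hμ0 : 0 ≤ μ := Finset.sum_nonneg fun b _ => Finset.sum_nonneg fun c _ =>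
    mul_nonneg (mul_nonneg (hp b) (hp c)) (sq_nonneg _)
  set T := quadForm B g
  set φ : ℝ → ℂ := fun s => prodExp p (fun ω => Complex.exp (Complex.I * ↑(s * T ω))) with hφ
  set φ' : ℝ → ℂ := fun s =>
    Complex.I * prodExp p (fun ω => (T ω : ℂ) * Complex.exp (Complex.I * ↑(s * T ω))) with hφ'
  have hφd : ∀ r, HasDerivAt φ (φ' r) r := by
    intro r
    have e : φ' r = ∑ ω : ι → L, (∏ i, p (ω i)) •
        (Complex.exp (Complex.I * ↑(r * T ω)) * (Complex.I * T ω)) := by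
      simp only [hφ', prodExp, Finset.mul_sum, Complex.real_smul]
      exact Finset.sum_congr rfl fun ω _ => by ring
    rw [e]
    refine HasDerivAt.fun_sum fun ω _ => HasDerivAt.const_smul _ ?_
    have h1 : HasDerivAt (fun r : ℝ => ((r * T ω : ℝ) : ℂ)) ((T ω : ℝ) : ℂ) r :=
      ((hasDerivAt_mul_const (T ω)).ofReal_comp)
    exact (h1.const_mul Complex.I).cexp
  set ε := prodExp p (fun ω => |∑ i, rowForm B g i ω ^ 2 - μ|)
  have hε : ε ≤ 20 * M ^ 2 * δ := by
    refine prodExp_abs_le hp hp1 (by positivity) ?_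
    refine (prodExp_sum_rowForm_sq_sub_le hp hp1 hBs hBd hB1 hgs hg0 hgM).trans ?_
    have : M ^ 4 * schattenFour B ≤ M ^ 4 * δ ^ 2 :=
      mul_le_mul_of_nonneg_left hQ (by positivity)
    nlinarith
  have hcube := prodExp_sum_abs_rowForm_cube_le hp hp1 hBs hBd hB1 hgs hg0 hgM hδ hQ
  set K := fun r : ℝ => (40 * M ^ 2 * |r| + 12 * r ^ 2 * (2 * M ^ 2 + 5 * M ^ 4)) * δ with hK
  have hode : ∀ r, ‖φ' r + 2 * r * μ * φ r‖ ≤ K r := by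
    intro r
    have hst := norm_stein_identity_le hp hp1 hBs hBd hgs hg0 r
    set A := prodExp p (fun ω => (T ω : ℂ) * Complex.exp (Complex.I * ↑(r * T ω)))
    set V := prodExp p (fun ω => ((∑ i, rowForm B g i ω ^ 2 : ℝ) : ℂ) *
      Complex.exp (Complex.I * ↑(r * T ω)))
    have hV : ‖V - μ * φ r‖ ≤ ε := by
      simp only [V, hφ]
      rw [← prodExp_const_mul, ← prodExp_sub]
      refine (norm_prodExp_le hp _).trans (le_of_eq ?_)
      congr 1
      ext ω
      rw [← sub_mul, norm_mul, Complex.norm_exp_I_mul_ofReal, mul_one, ← Complex.ofReal_sub,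
        Complex.norm_real, Real.norm_eq_abs]
    have e : φ' r + 2 * r * μ * φ r
        = Complex.I * (A - 2 * Complex.I * r * V) - 2 * r * (V - μ * φ r) := by
      simp only [hφ']
      have : Complex.I * (A - 2 * Complex.I * r * V)
          = Complex.I * A - 2 * (Complex.I * Complex.I) * r * V := by ring
      rw [this, Complex.I_mul_I]
      ring
    rw [e]
    refine (norm_sub_le _ _).trans ?_
    have n1 : ‖Complex.I * (A - 2 * Complex.I * r * V)‖ ≤ 12 * r ^ 2 *
        ((2 * M ^ 2 + 5 * M ^ 4) * δ) := by
      rw [norm_mul, Complex.norm_I, one_mul]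
      exact hst.trans (mul_le_mul_of_nonneg_left hcube (by positivity))
    have n2 : ‖2 * (r : ℂ) * (V - μ * φ r)‖ ≤ 2 * |r| * (20 * M ^ 2 * δ) := by
      rw [norm_mul, norm_mul, Complex.norm_real, Real.norm_eq_abs, Complex.norm_two]
      exact mul_le_mul_of_nonneg_left (hV.trans hε) (by positivity)
    simp only [hK]
    linarith
  set ψ : ℝ → ℂ := fun r => φ r * Complex.exp ((r ^ 2 * μ : ℝ) : ℂ) with hψ
  have hψd : ∀ r, HasDerivAt ψ ((φ' r + 2 * r * μ * φ r) * Complex.exp ((r ^ 2 * μ : ℝ) : ℂ)) r := by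
    intro r
    have h1 : HasDerivAt (fun r : ℝ => ((r ^ 2 * μ : ℝ) : ℂ)) ((2 * r * μ : ℝ) : ℂ) r := by
      have := ((hasDerivAt_pow 2 r).mul_const μ).ofReal_comp
      simpa using this
    have := (hφd r).mul h1.cexp
    refine this.congr_deriv ?_
    push_cast
    ring
  have hbound : ∀ r ∈ Set.uIcc 0 s,
      ‖(φ' r + 2 * r * μ * φ r) * Complex.exp ((r ^ 2 * μ : ℝ) : ℂ)‖
        ≤ K s * Real.exp (s ^ 2 * μ) := by
    intro r hr
    have hrs : |r| ≤ |s| := by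
      have := Set.abs_sub_left_of_mem_uIcc hr
      simpa using this
    have hrs2 : r ^ 2 ≤ s ^ 2 := sq_le_sq.mpr hrs
    rw [norm_mul, Complex.norm_exp_ofReal]
    refine mul_le_mul ((hode r).trans ?_) (Real.exp_le_exp.mpr
      (mul_le_mul_of_nonneg_right hrs2 hμ0)) (Real.exp_pos _).le ?_
    · simp only [hK]
      gcongr
    · simp only [hK]
      positivity
  have hmv := Convex.norm_image_sub_le_of_norm_hasDerivWithin_le
    (fun r _ => (hψd r).hasDerivWithinAt) hbound (convex_uIcc 0 s) Set.left_mem_uIcc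
    Set.right_mem_uIcc
  have hψ0 : ψ 0 = 1 := by simp [hψ, hφ, prodExp_const hp1]
  have hfin : φ s - Complex.exp (-(s ^ 2 * μ : ℝ))
      = (ψ s - ψ 0) * Complex.exp ((-(s ^ 2 * μ) : ℝ) : ℂ) := by
    rw [hψ0]
    simp only [hψ]
    rw [sub_mul, mul_assoc, ← Complex.exp_add]
    push_cast
    simp
  rw [hfin, norm_mul, Complex.norm_exp_ofReal]
  calc ‖ψ s - ψ 0‖ * Real.exp (-(s ^ 2 * μ))
      ≤ (K s * Real.exp (s ^ 2 * μ) * ‖s - 0‖) * Real.exp (-(s ^ 2 * μ)) :=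
        mul_le_mul_of_nonneg_right hmv (Real.exp_pos _).le
    _ = K s * |s| * (Real.exp (s ^ 2 * μ) * Real.exp (-(s ^ 2 * μ))) := by
        rw [sub_zero, Real.norm_eq_abs]; ring
    _ = K s * |s| := by rw [← Real.exp_add]; simp
    _ = _ := by
        simp only [hK]
        rw [← sq_abs s]
        ring

end QuadraticFormCLT

section PermutationMoments

variable {n : ℕ}

lemma pexp_add (f g : Equiv.Perm (Fin n) → ℝ) :
    pexp n (fun π => f π + g π) = pexp n f + pexp n g := by
  simp [pexp, Finset.sum_add_distrib, add_div]

lemma pexp_const_mul (c : ℝ) (f : Equiv.Perm (Fin n) → ℝ) :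
    pexp n (fun π => c * f π) = c * pexp n f := by
  simp [pexp, ← Finset.mul_sum, mul_div_assoc]

lemma pexp_sum {κ : Type*} (s : Finset κ) (f : κ → Equiv.Perm (Fin n) → ℝ) :
    pexp n (fun π => ∑ k ∈ s, f k π) = ∑ k ∈ s, pexp n (f k) := by
  simp only [pexp]
  rw [Finset.sum_comm, Finset.sum_div]

lemma pexp_const (c : ℝ) : pexp n (fun _ => c) = c := by
  have : (n.factorial : ℝ) ≠ 0 := by exact_mod_cast n.factorial_ne_zero
  simp only [pexp, Finset.sum_const, Finset.card_univ, Fintype.card_perm, Fintype.card_fin,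
    nsmul_eq_mul]
  field_simp

lemma pexp_mono {f g : Equiv.Perm (Fin n) → ℝ} (h : ∀ π, f π ≤ g π) : pexp n f ≤ pexp n g := by
  unfold pexp
  gcongr
  exact h _

lemma pexp_mul_right (f : Equiv.Perm (Fin n) → ℝ) (τ : Equiv.Perm (Fin n)) :
    pexp n (fun π => f (π * τ)) = pexp n f := by
  unfold pexp
  congr 1
  exact Fintype.sum_equiv (Equiv.mulRight τ) _ _ fun π => rfl

/-- Indicator of the first `t` indices. -/
noncomputable def headInd (t : ℕ) (a : Fin n) : ℝ := if (a : ℕ) < t then 1 else 0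

lemma sum_headInd {t : ℕ} (ht : t ≤ n) : ∑ a : Fin n, headInd t a = t := by
  simp only [headInd, Finset.sum_boole]
  rw [Fin.card_filter_val_lt]
  simp [ht]

/-- Sum of the entries of `B` over pairs among the first `t` positions of the arrangement `π`. -/
noncomputable def headSum (B : Fin n → Fin n → ℝ) (t : ℕ) (π : Equiv.Perm (Fin n)) : ℝ :=
  ∑ a, ∑ b, headInd t a * headInd t b * B (π a) (π b)

lemma U1_zero_eq_headSum (B : Fin n → Fin n → ℝ) (π : Equiv.Perm (Fin n)) (t : ℕ) :
    U1 n B π 0 t = headSum B t π := by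
  unfold U1 headSum headInd
  refine Finset.sum_congr rfl fun a _ => Finset.sum_congr rfl fun b _ => ?_
  by_cases ha : (a : ℕ) < t <;> by_cases hb : (b : ℕ) < t <;> simp [ha, hb]

lemma headInd_swap {t : ℕ} {c d : Fin n} (h : (c : ℕ) < t ↔ (d : ℕ) < t) (a : Fin n) :
    headInd t (Equiv.swap c d a) = headInd t a := by
  unfold headInd
  rcases eq_or_ne a c with rfl | hc
  · simp [h]
  rcases eq_or_ne a d with rfl | hd
  · simp [h]
  · rw [Equiv.swap_apply_of_ne_of_ne hc hd]

lemma headSum_mul_right (B : Fin n → Fin n → ℝ) {t : ℕ} {τ : Equiv.Perm (Fin n)}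
    (hτ : ∀ a, headInd t (τ a) = headInd t a) (π : Equiv.Perm (Fin n)) :
    headSum B t (π * τ) = headSum B t π := by
  unfold headSum
  refine Fintype.sum_equiv τ _ _ fun a => Fintype.sum_equiv τ _ _ fun b => ?_
  simp [hτ]

lemma headInd_succ {t : ℕ} (ht : t < n) (a : Fin n) :
    headInd (t + 1) a = headInd t a + if a = ⟨t, ht⟩ then 1 else 0 := by
  unfold headInd
  simp only [Fin.ext_iff]
  rcases lt_trichotomy (a : ℕ) t with h | h | h
  · simp [h, h.ne, h.trans (Nat.lt_succ_self t)]
  · simp [h]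
  · have h1 : ¬ (a : ℕ) < t := by omega
    have h2 : ¬ (a : ℕ) < t + 1 := by omega
    simp [h1, h2, h.ne']

variable {B : Fin n → Fin n → ℝ}

lemma headSum_succ (hBs : ∀ i j, B i j = B j i) (hBd : ∀ i, B i i = 0) {t : ℕ} (ht : t < n)
    (π : Equiv.Perm (Fin n)) :
    headSum B (t + 1) π = headSum B t π + 2 * ∑ a, headInd t a * B (π a) (π ⟨t, ht⟩) := by
  have e : ∀ a b : Fin n, headInd (t + 1) a * headInd (t + 1) b * B (π a) (π b) =
      headInd t a * headInd t b * B (π a) (π b)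
      + (if b = ⟨t, ht⟩ then headInd t a * B (π a) (π b) else 0)
      + ((if a = ⟨t, ht⟩ then headInd t b * B (π a) (π b) else 0)
      + if a = ⟨t, ht⟩ then (if b = ⟨t, ht⟩ then B (π a) (π b) else 0) else 0) := by
    intro a b
    rw [headInd_succ ht, headInd_succ ht]
    split_ifs <;> ring
  simp only [headSum, e, Finset.sum_add_distrib]
  rw [Finset.sum_comm (f := fun a b => if a = ⟨t, ht⟩ then headInd t b * B (π a) (π b) else 0)]
  simp only [Finset.sum_ite_eq', mem_univ, if_true]
  have : ∀ b, B (π ⟨t, ht⟩) (π b) = B (π b) (π ⟨t, ht⟩) := fun b => hBs _ _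
  simp only [Finset.sum_ite_irrel, Finset.sum_const_zero, this, Finset.sum_ite_eq', mem_univ, if_true, hBd]
  ring

/-- One-step conditional expectation of the head sum. -/
lemma pexp_mul_headSum_succ (hBs : ∀ i j, B i j = B j i) (hBd : ∀ i, B i i = 0)
    (hB0 : ∀ i, ∑ j, B i j = 0) {t : ℕ} (ht : t < n) {f : Equiv.Perm (Fin n) → ℝ}
    (hf : ∀ d : Fin n, t ≤ d → ∀ π, f (π * Equiv.swap ⟨t, ht⟩ d) = f π) :
    ((n : ℝ) - t) * pexp n (fun π => f π * headSum B (t + 1) π) =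
      ((n : ℝ) - t - 2) * pexp n (fun π => f π * headSum B t π) := by
  set X : Fin n → ℝ := fun d => pexp n (fun π => f π * ∑ a, headInd t a * B (π a) (π d)) with hX
  have hXd : ∀ d : Fin n, t ≤ d → X d = X ⟨t, ht⟩ := by
    intro d hd
    rw [hX]
    simp only
    rw [← pexp_mul_right _ (Equiv.swap ⟨t, ht⟩ d)]
    congr 1
    ext π
    rw [hf d hd π]
    congr 1
    have hi := headInd_swap (n := n) (t := t) (c := ⟨t, ht⟩) (d := d) (by simp [hd])
    refine Fintype.sum_equiv (Equiv.swap ⟨t, ht⟩ d) _ _ fun a => ?_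
    simp [hi]
  have hsum : ∑ d, (1 - headInd t d) * X d = ((n : ℝ) - t) * X ⟨t, ht⟩ := by
    have : ∀ d, (1 - headInd t d) * X d = (1 - headInd t d) * X ⟨t, ht⟩ := by
      intro d
      by_cases hd : (d : ℕ) < t
      · simp [headInd, hd]
      · rw [hXd d (not_lt.mp hd)]
    rw [Finset.sum_congr rfl fun d _ => this d, ← Finset.sum_mul, Finset.sum_sub_distrib,
      sum_headInd ht.le]
    simp
  have hsum2 : ∑ d, (1 - headInd t d) * X d = - pexp n (fun π => f π * headSum B t π) := by
    simp only [hX, ← pexp_const_mul]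
    rw [← pexp_sum, ← neg_one_mul, ← pexp_const_mul]
    congr 1
    ext π
    have h0 : ∑ d, ∑ a, headInd t a * B (π a) (π d) = 0 := by
      rw [Finset.sum_comm]
      refine Finset.sum_eq_zero fun a _ => ?_
      rw [← Finset.mul_sum, Equiv.sum_comp π (fun d => B (π a) d), hB0, mul_zero]
    have h1 : headSum B t π = ∑ d, headInd t d * ∑ a, headInd t a * B (π a) (π d) := by
      unfold headSum
      rw [Finset.sum_comm]
      refine Finset.sum_congr rfl fun b _ => ?_
      rw [Finset.mul_sum]
      exact Finset.sum_congr rfl fun a _ => by ring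
    rw [h1]
    calc _ = f π * ∑ d, ∑ a, headInd t a * B (π a) (π d)
          - f π * ∑ d, headInd t d * ∑ a, headInd t a * B (π a) (π d) := by
          rw [Finset.mul_sum, Finset.mul_sum, ← Finset.sum_sub_distrib]
          exact Finset.sum_congr rfl fun d _ => by ring
      _ = _ := by rw [h0]; ring
  have hstep : pexp n (fun π => f π * headSum B (t + 1) π) =
      pexp n (fun π => f π * headSum B t π) + 2 * X ⟨t, ht⟩ := by
    rw [hX]
    simp only
    rw [← pexp_const_mul, ← pexp_add]
    congr 1
    ext π
    rw [headSum_succ hBs hBd ht]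
    ring
  rw [hstep]
  linear_combination 2 * hsum2 - 2 * hsum

lemma exists_perm_pair {t : ℕ} {a b c d : Fin n} (hab : a ≠ b) (hcd : c ≠ d) (ha : (a : ℕ) < t)
    (hb : (b : ℕ) < t) (hc : (c : ℕ) < t) (hd : (d : ℕ) < t) :
    ∃ τ : Equiv.Perm (Fin n), τ a = c ∧ τ b = d ∧ ∀ x, headInd t (τ x) = headInd t x := by
  have hlt : ((Equiv.swap a c d : Fin n) : ℕ) < t := by
    have := headInd_swap (t := t) (c := a) (d := c) (by simp [ha, hc]) d
    unfold headInd at this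
    by_contra h
    simp [h, hd] at this
  refine ⟨Equiv.swap a c * Equiv.swap b (Equiv.swap a c d), ?_, ?_, ?_⟩
  · have h1 : a ≠ Equiv.swap a c d := by
      intro h
      have := congrArg (Equiv.swap a c) h
      simp at this
      exact hcd this
    rw [Equiv.Perm.mul_apply, Equiv.swap_apply_of_ne_of_ne hab h1]
    simp
  · simp
  · intro x
    rw [Equiv.Perm.mul_apply, headInd_swap (by simp [ha, hc]), headInd_swap (by simp [hb, hlt])]

lemma pexp_entry_mul_headSum_congr {t : ℕ} {a b c d : Fin n} (hab : a ≠ b) (hcd : c ≠ d)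
    (ha : (a : ℕ) < t) (hb : (b : ℕ) < t) (hc : (c : ℕ) < t) (hd : (d : ℕ) < t) :
    pexp n (fun π => B (π a) (π b) * headSum B t π) =
      pexp n (fun π => B (π c) (π d) * headSum B t π) := by
  obtain ⟨τ, h1, h2, h3⟩ := exists_perm_pair hab hcd ha hb hc hd
  rw [← pexp_mul_right (fun π => B (π a) (π b) * headSum B t π) τ]
  congr 1
  ext π
  rw [headSum_mul_right B h3]
  simp [h1, h2]

lemma pexp_entry_sq {a b : Fin n} (hBd : ∀ i, B i i = 0) (hab : a ≠ b) :
    (n : ℝ) * (n - 1) * pexp n (fun π => B (π a) (π b) ^ 2) = ∑ i, ∑ j, B i j ^ 2 := by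
  have h1 : pexp n (fun π => ∑ c, ∑ d, B (π c) (π d) ^ 2) = ∑ i, ∑ j, B i j ^ 2 := by
    rw [← pexp_const (n := n) (∑ i, ∑ j, B i j ^ 2)]
    congr 1
    ext π
    rw [Equiv.sum_comp π (fun c => ∑ d, B c (π d) ^ 2)]
    exact Finset.sum_congr rfl fun c _ => Equiv.sum_comp π (fun d => B c d ^ 2)
  set K := pexp n (fun π => B (π a) (π b) ^ 2) with hK
  have h2 : ∀ c d : Fin n, pexp n (fun π => B (π c) (π d) ^ 2) =
      if c = d then 0 else K := by
    intro c d
    split_ifs with h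
    · subst h
      simp only [hBd]
      simp [pexp]
    · obtain ⟨τ, h1, h2, -⟩ := exists_perm_pair (t := n) h hab c.2 d.2 a.2 b.2
      rw [← pexp_mul_right _ τ]
      simp [h1, h2, hK]
  rw [← h1, pexp_sum]
  simp only [pexp_sum, h2]
  have h3 : ∀ c : Fin n, ∑ d : Fin n, (if c = d then 0 else K)
      = ((n : ℝ) - 1) * K := by
    intro c
    have : ∀ d : Fin n, (if c = d then 0 else K) =
      K - if c = d then K else 0 := by
      intro d
      split_ifs <;> simp
    rw [Finset.sum_congr rfl fun d _ => this d, Finset.sum_sub_distrib]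
    simp
    ring
  simp only [h3]
  simp
  ring

lemma pexp_entry_mul_headSum (hBs : ∀ i j, B i j = B j i) (hBd : ∀ i, B i i = 0)
    (hB0 : ∀ i, ∑ j, B i j = 0) (hn : 4 ≤ n) {t : ℕ} (ht2 : 2 ≤ t) (htn : t ≤ n) {a b : Fin n}
    (hab : a ≠ b) (ha : (a : ℕ) < t) (hb : (b : ℕ) < t) :
    (n : ℝ) * (n - 1) * (n - 2) * (n - 3) * pexp n (fun π => B (π a) (π b) * headSum B t π) =
      2 * ((n : ℝ) - t) * (n - t - 1) * ∑ i, ∑ j, B i j ^ 2 := by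
  set x : Fin n := ⟨0, lt_of_lt_of_le (by norm_num) hn⟩
  set y : Fin n := ⟨1, lt_of_lt_of_le (by norm_num) hn⟩
  have hxy : x ≠ y := by simp [x, y]
  rw [pexp_entry_mul_headSum_congr hab hxy ha hb (by simp [x]; omega) (by simp [y]; omega)]
  clear ha hb hab
  induction t, ht2 using Nat.le_induction with
  | base =>
    have h2 : ∀ π, B (π x) (π y) * headSum B 2 π = 2 * B (π x) (π y) ^ 2 := by
      intro π
      have hs0 : headSum B 0 π = 0 := by simp [headSum, headInd]
      have hi : ∀ c : Fin n, headInd 1 c = if c = x then 1 else 0 := by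
        intro c
        rw [headInd_succ (by omega : 0 < n)]
        simp [headInd, x]
      have := headSum_succ hBs hBd (by omega : 1 < n) π
      rw [headSum_succ hBs hBd (by omega : 0 < n) π, hs0] at this
      rw [this]
      simp only [hi]
      simp [headInd]
      change B (π x) (π y) * (2 * B (π x) (π y)) = _
      ring
    simp only [h2]
    rw [pexp_const_mul]
    have := pexp_entry_sq hBd hxy
    push_cast
    linear_combination 2 * ((n : ℝ) - 2) * (n - 3) * this
  | succ t ht ih =>
    have hlt : t < n := by omega
    have ih' := ih hlt.le
    have hrec := pexp_mul_headSum_succ hBs hBd hB0 hlt (f := fun π => B (π x) (π y)) (by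
      intro d hd π
      have h1 : Equiv.swap ⟨t, hlt⟩ d x = x := by
        refine Equiv.swap_apply_of_ne_of_ne ?_ ?_ <;> simp [x, Fin.ext_iff] <;> omega
      have h2 : Equiv.swap ⟨t, hlt⟩ d y = y := by
        refine Equiv.swap_apply_of_ne_of_ne ?_ ?_ <;> simp [y, Fin.ext_iff] <;> omega
      simp [h1, h2])
    have hpos : (n : ℝ) - t ≠ 0 := by
      have : (t : ℝ) < n := by exact_mod_cast hlt
      linarith
    apply mul_left_cancel₀ hpos
    push_cast
    linear_combination (n : ℝ) * (n - 1) * (n - 2) * (n - 3) * hrec + ((n : ℝ) - t - 2) * ih'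

/-- Covariance of head sums of a symmetric matrix with vanishing diagonal and row sums. -/
lemma pexp_headSum_mul_headSum (hBs : ∀ i j, B i j = B j i) (hBd : ∀ i, B i i = 0)
    (hB0 : ∀ i, ∑ j, B i j = 0) (hn : 4 ≤ n) {s t : ℕ} (hst : s ≤ t) (htn : t ≤ n) :
    (n : ℝ) * (n - 1) * (n - 2) * (n - 3) * pexp n (fun π => headSum B s π * headSum B t π) =
      2 * s * ((s : ℝ) - 1) * ((n : ℝ) - t) * (n - t - 1) * ∑ i, ∑ j, B i j ^ 2 := by
  set K := 2 * ((n : ℝ) - t) * (n - t - 1) * ∑ i, ∑ j, B i j ^ 2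
  have h : ∀ a b : Fin n, (n : ℝ) * (n - 1) * (n - 2) * (n - 3) *
      pexp n (fun π => headInd s a * headInd s b * B (π a) (π b) * headSum B t π) =
      headInd s a * headInd s b * K - if a = b then headInd s a * headInd s b * K else 0 := by
    intro a b
    have e : ∀ π, headInd s a * headInd s b * B (π a) (π b) * headSum B t π =
      headInd s a * headInd s b * (B (π a) (π b) * headSum B t π) := fun π => by ring
    simp only [e]
    rw [pexp_const_mul]
    split_ifs with hab
    · subst hab
      simp [hBd, pexp]
    · by_cases ha : (a : ℕ) < s
      · by_cases hb : (b : ℕ) < s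
        · have := pexp_entry_mul_headSum hBs hBd hB0 hn (t := t)
            (by have : (a : ℕ) ≠ b := fun h => hab (Fin.ext h)
                omega) htn hab (by omega) (by omega)
          linear_combination headInd s a * headInd s b * this
        · simp [headInd, hb]
      · simp [headInd, ha]
  have e : ∀ π, headSum B s π * headSum B t π =
      ∑ a, ∑ b, headInd s a * headInd s b * B (π a) (π b) * headSum B t π := by
    intro π
    conv_lhs => rw [headSum]
    simp only [Finset.sum_mul]
  simp only [e]
  rw [pexp_sum]
  simp only [pexp_sum, Finset.mul_sum, h]
  simp only [Finset.sum_sub_distrib, ← Finset.sum_mul, ← Finset.mul_sum, sum_headInd (hst.trans htn)]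
  simp only [Finset.sum_ite_eq, mem_univ, if_true]
  have hsq : ∀ a : Fin n, headInd s a * headInd s a = headInd s a := by
    intro a
    unfold headInd
    split_ifs <;> simp
  simp only [hsq, ← Finset.sum_mul, sum_headInd (hst.trans htn)]
  simp only [K]
  ring

end PermutationMoments

section Coupling

variable {n : ℕ}

/-- Average of a vector-valued function over all permutations. -/
noncomputable def permAvg {E : Type*} [NormedAddCommGroup E] [NormedSpace ℝ E]
    (f : Equiv.Perm (Fin n) → E) : E :=
  (n.factorial : ℝ)⁻¹ • ∑ π, f π

lemma norm_permAvg_sub_le {E : Type*} [NormedAddCommGroup E] [NormedSpace ℝ E]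
    (f g : Equiv.Perm (Fin n) → E) :
    ‖permAvg f - permAvg g‖ ≤ pexp n (fun π => ‖f π - g π‖) := by
  unfold permAvg pexp
  rw [← smul_sub, ← Finset.sum_sub_distrib, norm_smul, norm_inv, Real.norm_natCast, div_eq_inv_mul]
  gcongr
  exact norm_sum_le _ _

lemma permAvg_const {E : Type*} [NormedAddCommGroup E] [NormedSpace ℝ E] (x : E) :
    permAvg (fun _ : Equiv.Perm (Fin n) => x) = x := by
  have : (n.factorial : ℝ) ≠ 0 := by exact_mod_cast n.factorial_ne_zero
  simp only [permAvg, Finset.sum_const, Finset.card_univ, Fintype.card_perm, Fintype.card_fin]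
  rw [← Nat.cast_smul_eq_nsmul ℝ, smul_smul, inv_mul_cancel₀ this, one_smul]

lemma pexp_abs_le_add {f : Equiv.Perm (Fin n) → ℝ} {δ : ℝ} (hδ : 0 < δ) :
    pexp n (fun π => |f π|) ≤ δ / 2 + (2 * δ)⁻¹ * pexp n (fun π => f π ^ 2) := by
  rw [← pexp_const_mul, ← pexp_const (n := n) (δ / 2), ← pexp_add]
  refine pexp_mono fun π => ?_
  rw [← sq_abs (f π)]
  have : 0 ≤ (|f π| - δ) ^ 2 / (2 * δ) := by positivity
  have e : (|f π| - δ) ^ 2 / (2 * δ) = δ / 2 + (2 * δ)⁻¹ * |f π| ^ 2 - |f π| := by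
    field_simp
    ring
  linarith

/-- Increments of the head sums are small in mean square. -/
lemma pexp_headSum_sub_sq_le {B : Fin n → Fin n → ℝ} (hBs : ∀ i j, B i j = B j i)
    (hBd : ∀ i, B i i = 0) (hB0 : ∀ i, ∑ j, B i j = 0) (hB1 : ∑ i, ∑ j, B i j ^ 2 = 1)
    (hn : 6 ≤ n) {s t : ℕ} (hs : s ≤ n) (ht : t ≤ n) :
    pexp n (fun π => (headSum B s π - headSum B t π) ^ 2) ≤ 32 * |(s : ℝ) - t| / n := by
  wlog hst : s ≤ t generalizing s t
  · have := this ht hs (le_of_not_ge hst)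
    rw [abs_sub_comm]
    convert this using 3
    ring
  have e : pexp n (fun π => (headSum B s π - headSum B t π) ^ 2) =
      pexp n (fun π => headSum B s π * headSum B s π)
      + (-2) * pexp n (fun π => headSum B s π * headSum B t π)
      + pexp n (fun π => headSum B t π * headSum B t π) := by
    rw [← pexp_const_mul, ← pexp_add, ← pexp_add]
    congr 1
    ext π
    ring
  have h1 := pexp_headSum_mul_headSum hBs hBd hB0 (by omega) le_rfl hs
  have h2 := pexp_headSum_mul_headSum hBs hBd hB0 (by omega) hst ht
  have h3 := pexp_headSum_mul_headSum hBs hBd hB0 (by omega) le_rfl ht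
  rw [hB1] at h1 h2 h3
  set E := pexp n (fun π => (headSum B s π - headSum B t π) ^ 2)
  have hn' : (6 : ℝ) ≤ n := by exact_mod_cast hn
  have hst' : (s : ℝ) ≤ t := by exact_mod_cast hst
  have ht' : (t : ℝ) ≤ n := by exact_mod_cast ht
  have hs0 : (0 : ℝ) ≤ s := s.cast_nonneg
  set N := (n : ℝ)
  set x := (s : ℝ)
  set y := (t : ℝ)
  have key : N * (N - 1) * (N - 2) * (N - 3) * E =
      2 * ((y - x) * (y + x - 1) * ((N - y) * (N - y - 1))
        + x * (x - 1) * ((y - x) * (2 * N - x - y - 1))) := by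
    rw [e]
    linear_combination h1 - 2 * h2 + h3
  have ht1 : (t = 0) ∨ 1 ≤ t := by omega
  have hfy : (N - y) * (N - y - 1) ≤ N ^ 2 := by nlinarith
  have hfy0 : 0 ≤ (N - y) * (N - y - 1) := by
    rcases ht.lt_or_eq with h | h
    · have : y + 1 ≤ N := by
        have : ((t + 1 : ℕ) : ℝ) ≤ n := by exact_mod_cast h
        push_cast at this
        exact this
      exact mul_nonneg (by linarith) (by linarith)
    · have : y = N := by simp only [y, N, h]
      rw [this]
      simp
  have hfx0 : 0 ≤ x * (x - 1) := by
    rcases Nat.eq_zero_or_pos s with h | h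
    · have : x = 0 := by simp only [x, h, Nat.cast_zero]
      rw [this]
      simp
    · have : (1 : ℝ) ≤ x := by
        simp only [x]
        exact_mod_cast h
      exact mul_nonneg (by linarith) (by linarith)
  have hfx : x * (x - 1) ≤ N ^ 2 := by nlinarith
  have b1 : (y - x) * (y + x - 1) * ((N - y) * (N - y - 1)) ≤ (y - x) * (2 * N) * N ^ 2 := by
    have hyx : 0 ≤ y - x := by linarith
    calc _ ≤ (y - x) * (2 * N) * ((N - y) * (N - y - 1)) := by
          gcongr
          linarith
      _ ≤ _ := by gcongr
  have b2 : x * (x - 1) * ((y - x) * (2 * N - x - y - 1)) ≤ N ^ 2 * ((y - x) * (2 * N)) := by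
    have hyx : 0 ≤ y - x := by linarith
    calc _ ≤ x * (x - 1) * ((y - x) * (2 * N)) := by
          gcongr
          linarith
      _ ≤ _ := by gcongr
  have hE0 : 0 ≤ E := by
    rw [← pexp_const (n := n) 0]
    exact pexp_mono fun π => sq_nonneg _
  have b3 : N ^ 4 / 4 ≤ N * (N - 1) * (N - 2) * (N - 3) := by
    have : N * (N - 1) * (N - 2) * (N - 3) - N ^ 4 / 4
      = N * ((N - 6) * (3 / 4 * (N - 6) ^ 2 + 15/2 * (N - 6) + 20) + 6) := by ring
    have hy : 0 ≤ N - 6 := by linarith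
    have h1 : 0 ≤ 3 / 4 * (N - 6) ^ 2 + 15/2 * (N - 6) + 20 := by
      have := sq_nonneg (N - 6)
      linarith
    have h2 : 0 ≤ N * ((N - 6) * (3 / 4 * (N - 6) ^ 2 + 15/2 * (N - 6) + 20) + 6) :=
      mul_nonneg (by linarith) (add_nonneg (mul_nonneg hy h1) (by norm_num))
    linarith
  have b4 : N ^ 4 / 4 * E ≤ 8 * N ^ 3 * (y - x) := by
    calc _ ≤ N * (N - 1) * (N - 2) * (N - 3) * E := by gcongr
      _ ≤ _ := by
        rw [key]
        linarith
  rw [abs_sub_comm, abs_of_nonneg (by linarith : 0 ≤ y - x), le_div_iff₀ (by linarith)]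
  have hN3 : 0 < N ^ 3 / 4 := by positivity
  refine le_of_mul_le_mul_left ?_ hN3
  linarith

variable {L : Type*} [LinearOrder L]

/-- Indicator of the labels that are at most `k`. -/
def labelInd (k b : L) : ℝ := if b ≤ k then 1 else 0

/-- Number of items with label at most `k`. -/
def labelCount (k : L) (ω : Fin n → L) : ℕ := #{i | ω i ≤ k}

lemma labelCount_eq_sum (k : L) (ω : Fin n → L) :
    (labelCount k ω : ℝ) = ∑ i, labelInd k (ω i) := by
  simp [labelCount, labelInd]

lemma labelCount_le (k : L) (ω : Fin n → L) : labelCount k ω ≤ n :=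
  (Finset.card_le_univ _).trans_eq (Fintype.card_fin n)

lemma headInd_labelCount (k : L) (ω : Fin n → L) (a : Fin n) :
    headInd (labelCount k ω) a = labelInd k (ω (Tuple.sort ω a)) := by
  have h1 : labelCount k ω = #{i | (ω ∘ Tuple.sort ω) i ≤ k} := by
    refine Finset.card_bij' (fun i _ => (Tuple.sort ω).symm i) (fun i _ => Tuple.sort ω i)
      ?_ ?_ ?_ ?_ <;> simp
  unfold headInd labelInd
  rw [h1]
  simp only [Tuple.lt_card_le_iff_apply_le_of_monotone (Tuple.monotone_sort ω)]
  rfl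

/-- Sum of the entries of `B` over pairs of items with labels at most `k`. -/
def labelSum (B : Fin n → Fin n → ℝ) (k : L) (ω : Fin n → L) : ℝ :=
  ∑ i, ∑ j, B i j * (labelInd k (ω i) * labelInd k (ω j))

lemma headSum_labelCount (B : Fin n → Fin n → ℝ) (k : L) (ω : Fin n → L)
    (π : Equiv.Perm (Fin n)) :
    headSum B (labelCount k ω) π = labelSum B k (ω ∘ (Tuple.sort ω * π⁻¹ : Equiv.Perm (Fin n))) := by
  unfold headSum labelSum
  refine Fintype.sum_equiv π _ _ fun a => Fintype.sum_equiv π _ _ fun b => ?_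
  simp [headInd_labelCount]
  ring

variable [Fintype L] {κ : Type*} [Fintype κ]

lemma prodExp_comp_perm {ι E : Type*} [Fintype ι] [DecidableEq ι] [NormedAddCommGroup E]
    [NormedSpace ℝ E] (p : L → ℝ) (f : (ι → L) → E) (τ : Equiv.Perm ι) :
    prodExp p (fun ω => f (ω ∘ τ)) = prodExp p f := by
  unfold prodExp
  refine Fintype.sum_equiv (Equiv.arrowCongr τ.symm (Equiv.refl L)) _ _ fun ω => ?_
  have : ∏ i, p ((Equiv.arrowCongr τ.symm (Equiv.refl L)) ω i) = ∏ i, p (ω i) := by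
    simp only [Equiv.arrowCongr_apply, Function.comp_apply, Equiv.refl_apply, Equiv.symm_symm]
    exact Equiv.prod_comp τ (fun i => p (ω i))
  rw [this]
  rfl

/-- Assigning i.i.d. labels to the items is the same as arranging the items at random and cutting
the arrangement at the independent random label counts. -/
lemma prodExp_labelSum_eq {E : Type*} [NormedAddCommGroup E] [NormedSpace ℝ E] (p : L → ℝ)
    (B : Fin n → Fin n → ℝ) (k : κ → L) (θ : κ → ℝ) (F : ℝ → E) :
    prodExp p (fun ω => F (∑ q, θ q * labelSum B (k q) ω)) =
      prodExp p (fun ω : Fin n → L => permAvg (fun π => F (∑ q, θ q * headSum B (labelCount (k q) ω) π))) := by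
  set f : (Fin n → L) → E := fun ω => F (∑ q, θ q * labelSum B (k q) ω) with hf
  have h1 : ∀ ω : Fin n → L, permAvg (fun π => F (∑ q, θ q * headSum B (labelCount (k q) ω) π)) =
      permAvg (fun τ : Equiv.Perm (Fin n) => f (ω ∘ τ)) := by
    intro ω
    unfold permAvg
    congr 1
    refine Fintype.sum_equiv ((Equiv.inv _).trans (Equiv.mulLeft (Tuple.sort ω))) _ _ fun π => ?_
    simp only [hf, headSum_labelCount]
    rfl
  simp only [h1]
  have h2 : prodExp p (fun ω => permAvg (fun τ : Equiv.Perm (Fin n) => f (ω ∘ τ))) =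
      permAvg (fun τ : Equiv.Perm (Fin n) => prodExp p (fun ω => f (ω ∘ τ))) := by
    simp only [permAvg, prodExp, Finset.smul_sum]
    rw [Finset.sum_comm]
    exact Finset.sum_congr rfl fun π _ => Finset.sum_congr rfl fun ω _ => smul_comm _ _ _
  rw [h2]
  simp only [prodExp_comp_perm]
  rw [permAvg_const]

/-- Mean absolute deviation of a label count. -/
lemma prodExp_abs_labelCount_sub_le {p : L → ℝ} (hp : ∀ b, 0 ≤ p b) (hp1 : ∑ b, p b = 1) (k : L)
    {v : ℝ} (hv : ∑ b, p b * labelInd k b = v) :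
    prodExp p (fun ω : Fin n → L => |(labelCount k ω : ℝ) - n * v|) ≤ Real.sqrt n := by
  have hv0 : 0 ≤ v := by
    rw [← hv]
    refine Finset.sum_nonneg fun b _ => mul_nonneg (hp b) ?_
    unfold labelInd
    split_ifs <;> norm_num
  have hv1 : v ≤ 1 := by
    rw [← hv, ← hp1]
    refine Finset.sum_le_sum fun b _ => mul_le_of_le_one_right (hp b) ?_
    unfold labelInd
    split_ifs <;> norm_num
  refine prodExp_abs_le hp hp1 (Real.sqrt_nonneg _) ?_
  rw [Real.sq_sqrt (Nat.cast_nonneg n)]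
  have := prodExp_sq_sum_le (ι := Fin n) hp hp1 (r := 1) (fun _ => 1)
    (fun α ω => labelInd k (ω (α 0)) - v) (K := 1)
    (fun α _ => Function.injective_of_subsingleton α) ?_ ?_ ?_
  · refine le_trans (le_of_eq ?_) (this.trans (le_of_eq ?_))
    · congr 1
      ext ω
      simp only [one_mul]
      rw [sum_fin_one_fun (fun i => labelInd k (ω i) - v), labelCount_eq_sum]
      simp
    · simp
  · intro α _ q ω
    have hq : q = 0 := Subsingleton.elim _ _
    subst hq
    simp only [Function.update_self, mul_sub, Finset.sum_sub_distrib, ← Finset.sum_mul, hp1, hv]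
    ring
  · intro α β _ _ q hq ω b
    simp only [Set.mem_range, not_exists] at hq
    rw [Function.update_of_ne (hq 0)]
  · intro α ω
    rw [abs_le]
    unfold labelInd
    split_ifs <;> constructor <;> linarith

/-- Cutting at the label counts instead of at the deterministic positions `t q ≈ n v q` has an
asymptotically negligible effect. -/
lemma norm_prodExp_labelSum_sub_le {B : Fin n → Fin n → ℝ} (hBs : ∀ i j, B i j = B j i)
    (hBd : ∀ i, B i i = 0) (hB0 : ∀ i, ∑ j, B i j = 0) (hB1 : ∑ i, ∑ j, B i j ^ 2 = 1)
    (hn : 6 ≤ n) {p : L → ℝ} (hp : ∀ b, 0 ≤ p b) (hp1 : ∑ b, p b = 1) (k : κ → L) (θ v : κ → ℝ)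
    (hv : ∀ q, ∑ b, p b * labelInd (k q) b = v q) {t : κ → ℕ} (ht : ∀ q, t q ≤ n)
    (htv : ∀ q, |(t q : ℝ) - n * v q| ≤ 1) {F : ℝ → ℂ} {K δ : ℝ} (hK : 0 ≤ K) (hδ : 0 < δ)
    (hF : ∀ x y, ‖F x - F y‖ ≤ K * |x - y|) :
    ‖prodExp p (fun ω => F (∑ q, θ q * labelSum B (k q) ω))
        - permAvg (fun π => F (∑ q, θ q * headSum B (t q) π))‖
      ≤ K * (∑ q, |θ q|) * (δ / 2 + 16 / δ * ((Real.sqrt n + 1) / n)) := by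
  have hn0 : (0 : ℝ) < n := by
    have : 0 < n := by omega
    exact_mod_cast this
  rw [prodExp_labelSum_eq, ← prodExp_const (ι := Fin n) hp1
    (permAvg (fun π => F (∑ q, θ q * headSum B (t q) π))), ← prodExp_sub]
  refine (norm_prodExp_le hp _).trans ?_
  have h1 : ∀ ω : Fin n → L, ‖permAvg (fun π => F (∑ q, θ q * headSum B (labelCount (k q) ω) π)) -
      permAvg (fun π => F (∑ q, θ q * headSum B (t q) π))‖ ≤
      ∑ q, K * |θ q| * ((δ / 2 + 16 / δ * (1 / n))
        + 16 / δ / n * |(labelCount (k q) ω : ℝ) - n * v q|) := by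
    intro ω
    refine (norm_permAvg_sub_le _ _).trans ?_
    have h2 : ∀ π, ‖F (∑ q, θ q * headSum B (labelCount (k q) ω) π) -
        F (∑ q, θ q * headSum B (t q) π)‖ ≤
        ∑ q, K * |θ q| * |headSum B (labelCount (k q) ω) π - headSum B (t q) π| := by
      intro π
      refine (hF _ _).trans ?_
      rw [← Finset.sum_sub_distrib]
      refine (mul_le_mul_of_nonneg_left (Finset.abs_sum_le_sum_abs _ _) hK).trans_eq ?_
      rw [Finset.mul_sum]
      refine Finset.sum_congr rfl fun q _ => ?_
      rw [← mul_sub, abs_mul]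
      ring
    refine (pexp_mono h2).trans ?_
    rw [pexp_sum]
    refine Finset.sum_le_sum fun q _ => ?_
    rw [pexp_const_mul]
    refine mul_le_mul_of_nonneg_left ?_ (by positivity)
    refine (pexp_abs_le_add hδ).trans ?_
    have h3 := pexp_headSum_sub_sq_le hBs hBd hB0 hB1 hn (labelCount_le (k q) ω) (ht q)
    have h4 : |(labelCount (k q) ω : ℝ) - t q| ≤ |(labelCount (k q) ω : ℝ) - n * v q| + 1 := by
      have := abs_sub_le (labelCount (k q) ω : ℝ) (n * v q) (t q)
      rw [abs_sub_comm (n * v q) (t q : ℝ)] at this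
      linarith [htv q]
    calc _ ≤ δ / 2 + (2 * δ)⁻¹ * (32 * (|(labelCount (k q) ω : ℝ) - n * v q| + 1) / n) := by
          gcongr
          exact h3.trans (by gcongr)
      _ = _ := by
          field_simp
          ring
  refine (prodExp_mono hp h1).trans ?_
  rw [prodExp_sum]
  simp only [Finset.mul_sum, Finset.sum_mul]
  refine Finset.sum_le_sum fun q _ => ?_
  rw [prodExp_const_mul, prodExp_add, prodExp_const hp1, prodExp_const_mul]
  have h5 := prodExp_abs_labelCount_sub_le (n := n) hp hp1 (k q) (hv q)
  refine mul_le_mul_of_nonneg_left ?_ (by positivity)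
  calc _ ≤ δ / 2 + 16 / δ * (1 / n) + 16 / δ / n * Real.sqrt n := by gcongr
    _ = _ := by ring

/-- The centred kernel attached to a linear combination of label sums. -/
def labelKernel (k : κ → L) (θ v : κ → ℝ) (b c : L) : ℝ :=
  ∑ q, θ q * ((labelInd (k q) b - v q) * (labelInd (k q) c - v q))

lemma quadForm_labelKernel {B : Fin n → Fin n → ℝ} (hBs : ∀ i j, B i j = B j i)
    (hB0 : ∀ i, ∑ j, B i j = 0) (k : κ → L) (θ v : κ → ℝ) (ω : Fin n → L) :
    quadForm B (labelKernel k θ v) ω = ∑ q, θ q * labelSum B (k q) ω := by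
  have hB0' : ∀ j, ∑ i, B i j = 0 := fun j => by simpa only [hBs _ j] using hB0 j
  have hc : ∀ q, ∑ i, ∑ j, B i j * ((labelInd (k q) (ω i) - v q) * (labelInd (k q) (ω j) - v q))
      = labelSum B (k q) ω := by
    intro q
    have e : ∀ i j, B i j * ((labelInd (k q) (ω i) - v q) * (labelInd (k q) (ω j) - v q)) =
      B i j * (labelInd (k q) (ω i) * labelInd (k q) (ω j)) - v q * (B i j * labelInd (k q) (ω j))
      - (v q * (labelInd (k q) (ω i) - v q)) * B i j := fun i j => by ring
    simp only [e, Finset.sum_sub_distrib, ← Finset.mul_sum, hB0]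
    have : ∑ i, ∑ j, B i j * labelInd (k q) (ω j) = 0 := by
      rw [Finset.sum_comm]
      simp only [← Finset.sum_mul, hB0', zero_mul, Finset.sum_const_zero]
    rw [this]
    simp [labelSum]
  simp only [quadForm, rowForm, labelKernel, Finset.mul_sum]
  simp only [← hc, Finset.mul_sum]
  rw [Finset.sum_comm]
  rw [Finset.sum_congr rfl fun j _ => Finset.sum_comm]
  rw [Finset.sum_comm]
  refine Finset.sum_congr rfl fun q _ => ?_
  rw [Finset.sum_comm]
  exact Finset.sum_congr rfl fun i _ => Finset.sum_congr rfl fun j _ => by ring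

lemma labelKernel_comm (k : κ → L) (θ v : κ → ℝ) (b c : L) :
    labelKernel k θ v b c = labelKernel k θ v c b :=
  Finset.sum_congr rfl fun q _ => by ring

lemma sum_mul_labelKernel {p : L → ℝ} (hp1 : ∑ b, p b = 1) {k : κ → L} (θ : κ → ℝ) {v : κ → ℝ}
    (hv : ∀ q, ∑ b, p b * labelInd (k q) b = v q) (c : L) :
    ∑ b, p b * labelKernel k θ v b c = 0 := by
  simp only [labelKernel, Finset.mul_sum]
  rw [Finset.sum_comm]
  refine Finset.sum_eq_zero fun q _ => ?_
  have e : ∀ b, p b * (θ q * ((labelInd (k q) b - v q) * (labelInd (k q) c - v q))) =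
      (θ q * (labelInd (k q) c - v q)) * (p b * labelInd (k q) b - p b * v q) := fun b => by ring
  simp only [e, ← Finset.mul_sum, Finset.sum_sub_distrib, ← Finset.sum_mul, hv, hp1]
  ring

lemma abs_labelKernel_le (k : κ → L) (θ : κ → ℝ) {v : κ → ℝ} (hv0 : ∀ q, 0 ≤ v q)
    (hv1 : ∀ q, v q ≤ 1) (b c : L) : |labelKernel k θ v b c| ≤ ∑ q, |θ q| := by
  have h : ∀ q b, |labelInd (k q) b - v q| ≤ 1 := by
    intro q b
    have := hv0 q
    have := hv1 q
    rw [abs_le]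
    unfold labelInd
    split_ifs <;> constructor <;> linarith
  refine (Finset.abs_sum_le_sum_abs _ _).trans (Finset.sum_le_sum fun q _ => ?_)
  rw [abs_mul, abs_mul]
  have := mul_le_one₀ (h q b) (abs_nonneg _) (h q c)
  exact mul_le_of_le_one_right (abs_nonneg _) this

end Coupling

section Reduction

variable {n : ℕ}

/-- Squared Frobenius norm. -/
def frobSq (A : Fin n → Fin n → ℝ) : ℝ := ∑ i, ∑ j, A i j ^ 2

/-- Normalised row sum used to centre the off-diagonal entries. -/
noncomputable def rowShift (R : Fin n → Fin n → ℝ) (i : Fin n) : ℝ := (∑ j, R i j) / ((n : ℝ) - 2)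

/-- The correction which, added off the diagonal, makes all row sums vanish. -/
noncomputable def centreShift (R : Fin n → Fin n → ℝ) (i j : Fin n) : ℝ :=
  if i = j then 0 else (∑ l, rowShift R l) / ((n : ℝ) - 1) - rowShift R i - rowShift R j

/-- Double centring of a matrix with zero diagonal, keeping the diagonal zero. -/
noncomputable def centred (R : Fin n → Fin n → ℝ) (i j : Fin n) : ℝ := R i j + centreShift R i j

variable {R : Fin n → Fin n → ℝ}

lemma centred_comm (hRs : ∀ i j, R i j = R j i) (i j : Fin n) : centred R i j = centred R j i := by
  unfold centred centreShift
  rw [hRs i j]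
  congr 1
  simp only [eq_comm (a := i)]
  split_ifs <;> ring

lemma centred_self (hRd : ∀ i, R i i = 0) (i : Fin n) : centred R i i = 0 := by
  simp [centred, centreShift, hRd]

lemma sum_centred (hn : 3 ≤ n) (i : Fin n) : ∑ j, centred R i j = 0 := by
  have hn' : (3 : ℝ) ≤ n := by exact_mod_cast hn
  set K := (∑ l, rowShift R l) / ((n : ℝ) - 1) with hK
  have e : ∀ j, centred R i j = R i j + (K - rowShift R i - rowShift R j)
      - if i = j then K - rowShift R i - rowShift R j else 0 := by
    intro j
    unfold centred centreShift
    split_ifs <;> simp [hK]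
  simp only [e, Finset.sum_sub_distrib, Finset.sum_add_distrib]
  simp only [Finset.sum_ite_eq, mem_univ, if_true, Finset.sum_const, Finset.card_univ,
    Fintype.card_fin, nsmul_eq_mul]
  have h1 : ((n : ℝ) - 1) * K = ∑ l, rowShift R l := by
    rw [hK]
    have : (n : ℝ) - 1 ≠ 0 := by linarith
    field_simp
  have h2 : ((n : ℝ) - 2) * rowShift R i = ∑ j, R i j := by
    unfold rowShift
    have : (n : ℝ) - 2 ≠ 0 := by linarith
    field_simp
  linear_combination h1 - h2

lemma headInd_mul_self (t : ℕ) (a : Fin n) : headInd t a * headInd t a = headInd t a := by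
  unfold headInd
  split_ifs <;> simp

lemma headSum_centred {t : ℕ} (ht : t ≤ n) (π : Equiv.Perm (Fin n)) :
    headSum (centred R) t π = headSum R t π
      - 2 * ((t : ℝ) - 1) * ∑ a, headInd t a * rowShift R (π a)
      + (∑ l, rowShift R l) / ((n : ℝ) - 1) * (t * ((t : ℝ) - 1)) := by
  set K := (∑ l, rowShift R l) / ((n : ℝ) - 1) with hK
  have e : ∀ a b, headInd t a * headInd t b * centred R (π a) (π b) =
      headInd t a * headInd t b * R (π a) (π b) + K * (headInd t a * headInd t b)
      - headInd t b * (headInd t a * rowShift R (π a))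
      - headInd t a * (headInd t b * rowShift R (π b))
      - if a = b then headInd t a * headInd t b * K
        - headInd t b * (headInd t a * rowShift R (π a))
        - headInd t a * (headInd t b * rowShift R (π b)) else 0 := by
    intro a b
    unfold centred centreShift
    by_cases h : a = b
    · subst h
      simp
      ring
    · simp [h, hK]
      ring
  simp only [headSum, e, Finset.sum_sub_distrib, Finset.sum_add_distrib]
  simp only [Finset.sum_ite_eq, mem_univ, if_true, ← mul_assoc, headInd_mul_self]
  simp only [mul_assoc, ← Finset.mul_sum, ← Finset.sum_mul, sum_headInd ht, Finset.sum_sub_distrib]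
  ring

lemma U2_zero_eq (hRs : ∀ i j, R i j = R j i) (π : Equiv.Perm (Fin n)) (t : ℕ) :
    U2 n R π 0 t = (∑ i, ∑ j, R i j) - 2 * (∑ a, headInd t a * ∑ j, R (π a) j) + headSum R t π := by
  have e : ∀ i j : Fin n, (if ((i : ℕ) < 0 ∨ t ≤ (i : ℕ)) ∧ ((j : ℕ) < 0 ∨ t ≤ (j : ℕ)) then
      R (π i) (π j) else 0) = R (π i) (π j) - headInd t i * R (π i) (π j)
        - headInd t j * R (π j) (π i) + headInd t i * headInd t j * R (π i) (π j) := by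
    intro i j
    rw [hRs (π j) (π i)]
    unfold headInd
    by_cases ha : (i : ℕ) < t <;> by_cases hb : (j : ℕ) < t <;>
      simp [ha, hb, not_le.mpr, not_lt.mp]
  simp only [U2, e, Finset.sum_sub_distrib, Finset.sum_add_distrib]
  rw [Finset.sum_comm (f := fun i j => headInd t j * R (π j) (π i))]
  simp only [← Finset.mul_sum]
  have h : ∀ i, ∑ j, R (π i) (π j) = ∑ j, R (π i) j := fun i => Equiv.sum_comp π (fun j => R (π i) j)
  simp only [h]
  rw [Equiv.sum_comp π (fun i => ∑ j, R i j), headSum]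
  ring

/-- The weighted statistic is, up to an additive constant, the head sum of the centred matrix. -/
lemma exists_Uw_eq (hRs : ∀ i j, R i j = R j i) (hn : 3 ≤ n) {t : ℕ} (ht : t ≤ n) :
    ∃ C : ℝ, ∀ π, Uw n R π 0 t = headSum (centred R) t π + C := by
  refine ⟨((t : ℝ) - 1) * (∑ i, ∑ j, R i j) / ((n : ℝ) - 2)
    - (∑ l, rowShift R l) / ((n : ℝ) - 1) * (t * ((t : ℝ) - 1)), fun π => ?_⟩
  have hn' : (3 : ℝ) ≤ n := by exact_mod_cast hn
  have h2 : (n : ℝ) - 2 ≠ 0 := by linarith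
  rw [headSum_centred ht, Uw, U1_zero_eq_headSum, U2_zero_eq hRs]
  have h3 : ∑ a, headInd t a * rowShift R (π a) =
      (∑ a, headInd t a * ∑ j, R (π a) j) / ((n : ℝ) - 2) := by
    rw [Finset.sum_div]
    exact Finset.sum_congr rfl fun a _ => by rw [rowShift, mul_div_assoc]
  rw [h3]
  push_cast
  field_simp
  ring

lemma pexp_headSum {B : Fin n → Fin n → ℝ} (hBs : ∀ i j, B i j = B j i)
    (hBd : ∀ i, B i i = 0) (hB0 : ∀ i, ∑ j, B i j = 0) {t : ℕ} (ht : t ≤ n) :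
    pexp n (headSum B t) = 0 := by
  induction t with
  | zero => simp [headSum, headInd, pexp]
  | succ t ih =>
    have h := pexp_mul_headSum_succ hBs hBd hB0 (by omega : t < n) (f := fun _ => 1)
      (fun _ _ _ => rfl)
    simp only [one_mul] at h
    have h0 : pexp n (fun π => headSum B t π) = 0 := ih (by omega)
    rw [h0, mul_zero] at h
    refine (mul_eq_zero.mp h).resolve_left ?_
    have : (t : ℝ) + 1 ≤ n := by exact_mod_cast ht
    linarith

lemma Zw_eq_of_centred (hRs : ∀ i j, R i j = R j i) (hRd : ∀ i, R i i = 0) (hn : 3 ≤ n) {t : ℕ}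
    (ht : t ≤ n) (π : Equiv.Perm (Fin n)) :
    Zw n R π 0 t = headSum (centred R) t π /
      Real.sqrt (pexp n (fun σ => headSum (centred R) t σ ^ 2)) := by
  obtain ⟨C, hC⟩ := exists_Uw_eq hRs hn ht
  have h0 : pexp n (fun σ => headSum (centred R) t σ) = 0 :=
    pexp_headSum (centred_comm hRs) (centred_self hRd) (sum_centred hn) ht
  have h1 : pexp n (fun σ => Uw n R σ 0 t) = C := by
    simp only [hC]
    rw [pexp_add, h0, pexp_const, zero_add]
  unfold Zw pvar
  rw [h1]
  simp only [hC, add_sub_cancel_right]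

/-- Centred matrix scaled to Frobenius norm one. -/
noncomputable def unitCentred (R : Fin n → Fin n → ℝ) (i j : Fin n) : ℝ :=
  (Real.sqrt (frobSq (centred R)))⁻¹ * centred R i j

lemma headSum_const_mul (c : ℝ) (B : Fin n → Fin n → ℝ) (t : ℕ) (π : Equiv.Perm (Fin n)) :
    headSum (fun i j => c * B i j) t π = c * headSum B t π := by
  simp only [headSum, Finset.mul_sum]
  exact Finset.sum_congr rfl fun a _ => Finset.sum_congr rfl fun b _ => by ring

lemma frobSq_unitCentred (h : 0 < frobSq (centred R)) :
    ∑ i, ∑ j, unitCentred R i j ^ 2 = 1 := by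
  simp only [unitCentred, mul_pow, ← Finset.mul_sum, inv_pow]
  rw [Real.sq_sqrt h.le]
  exact inv_mul_cancel₀ h.ne'

lemma schattenFour_unitCentred (h : 0 < frobSq (centred R)) :
    schattenFour (unitCentred R) = schattenFour (centred R) / frobSq (centred R) ^ 2 := by
  have e : ∀ i j k, unitCentred R i j * unitCentred R i k =
      (frobSq (centred R))⁻¹ * (centred R i j * centred R i k) := by
    intro i j k
    unfold unitCentred
    rw [show ∀ a b c : ℝ, a * b * (a * c) = a ^ 2 * (b * c) from fun a b c => by ring, inv_pow,
      Real.sq_sqrt h.le]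
  simp only [schattenFour, e, ← Finset.mul_sum, mul_pow]
  field_simp

/-- The standardised weighted statistic as a head sum with explicit normalisation. -/
lemma Zw_eq (hRs : ∀ i j, R i j = R j i) (hRd : ∀ i, R i i = 0) (hn : 4 ≤ n)
    (hf : 0 < frobSq (centred R)) {t : ℕ} (ht : t ≤ n) (π : Equiv.Perm (Fin n)) :
    Zw n R π 0 t = (Real.sqrt (2 * t * ((t : ℝ) - 1) * ((n : ℝ) - t) * (n - t - 1) /
      (n * (n - 1) * (n - 2) * (n - 3))))⁻¹ * headSum (unitCentred R) t π := by
  have hn' : (4 : ℝ) ≤ n := by exact_mod_cast hn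
  have hs : 0 < Real.sqrt (frobSq (centred R)) := Real.sqrt_pos.mpr hf
  have hN : (0 : ℝ) < n * (n - 1) * (n - 2) * (n - 3) :=
    mul_pos (mul_pos (mul_pos (by linarith) (by linarith)) (by linarith)) (by linarith)
  have h1 : pexp n (fun σ => headSum (centred R) t σ ^ 2) =
      frobSq (centred R) * (2 * t * ((t : ℝ) - 1) * ((n : ℝ) - t) * (n - t - 1) /
      (n * (n - 1) * (n - 2) * (n - 3))) := by
    have := pexp_headSum_mul_headSum (centred_comm hRs) (centred_self hRd)
      (sum_centred (R := R) (by omega)) hn (le_refl t) ht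
    simp only [← sq] at this
    rw [← mul_div_assoc, eq_div_iff hN.ne', mul_comm, this, frobSq]
    ring
  rw [Zw_eq_of_centred hRs hRd (by omega) ht, h1, Real.sqrt_mul hf.le]
  have h2 : headSum (unitCentred R) t π =
      (Real.sqrt (frobSq (centred R)))⁻¹ * headSum (centred R) t π := headSum_const_mul _ _ _ _
  rw [h2, div_eq_mul_inv, mul_inv]
  ring

end Reduction

section MatrixConditions

variable {n : ℕ}

lemma frobSq_nonneg (A : Fin n → Fin n → ℝ) : 0 ≤ frobSq A :=
  Finset.sum_nonneg fun _ _ => Finset.sum_nonneg fun _ _ => sq_nonneg _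

lemma schattenFour_nonneg {ι : Type*} [Fintype ι] (A : ι → ι → ℝ) : 0 ≤ schattenFour A :=
  Finset.sum_nonneg fun _ _ => Finset.sum_nonneg fun _ _ => sq_nonneg _

lemma sum_sq_sum_mul_le (A D : Fin n → Fin n → ℝ) :
    ∑ j, ∑ k, (∑ i, A i j * D i k) ^ 2 ≤ frobSq A * frobSq D := by
  unfold frobSq
  rw [Finset.sum_comm (f := fun i j => A i j ^ 2), Finset.sum_comm (f := fun i j => D i j ^ 2),
    Finset.sum_mul_sum]
  exact Finset.sum_le_sum fun j _ => Finset.sum_le_sum fun k _ =>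
    Finset.sum_mul_sq_le_sq_mul_sq _ _ _

lemma schattenFour_add_le (A D : Fin n → Fin n → ℝ) :
    schattenFour (fun i j => A i j + D i j) ≤
      4 * (schattenFour A + 2 * (frobSq A * frobSq D) + frobSq D ^ 2) := by
  have h : ∀ j k, (∑ i, (A i j + D i j) * (A i k + D i k)) ^ 2 ≤
      4 * ((∑ i, A i j * A i k) ^ 2 + (∑ i, A i j * D i k) ^ 2 + (∑ i, D i j * A i k) ^ 2
        + (∑ i, D i j * D i k) ^ 2) := by
    intro j k
    have e : ∑ i, (A i j + D i j) * (A i k + D i k) = ∑ i, A i j * A i k + ∑ i, A i j * D i k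
        + ∑ i, D i j * A i k + ∑ i, D i j * D i k := by
      simp only [← Finset.sum_add_distrib]
      exact Finset.sum_congr rfl fun i _ => by ring
    rw [e]
    set a := ∑ i, A i j * A i k
    set b := ∑ i, A i j * D i k
    set c := ∑ i, D i j * A i k
    set d := ∑ i, D i j * D i k
    nlinarith [sq_nonneg (a - b), sq_nonneg (a - c), sq_nonneg (a - d), sq_nonneg (b - c),
      sq_nonneg (b - d), sq_nonneg (c - d)]
  have h1 := sum_sq_sum_mul_le A D
  have h2 := sum_sq_sum_mul_le D A
  have h3 := sum_sq_sum_mul_le D D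
  calc _ ≤ ∑ j, ∑ k, 4 * ((∑ i, A i j * A i k) ^ 2 + (∑ i, A i j * D i k) ^ 2
        + (∑ i, D i j * A i k) ^ 2 + (∑ i, D i j * D i k) ^ 2) :=
        Finset.sum_le_sum fun j _ => Finset.sum_le_sum fun k _ => h j k
    _ = 4 * (schattenFour A + ∑ j, ∑ k, (∑ i, A i j * D i k) ^ 2
        + ∑ j, ∑ k, (∑ i, D i j * A i k) ^ 2 + ∑ j, ∑ k, (∑ i, D i j * D i k) ^ 2) := by
        simp only [← Finset.mul_sum, Finset.sum_add_distrib, schattenFour]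
    _ ≤ _ := by nlinarith

variable {R : Fin n → Fin n → ℝ}

lemma r1sq_nonneg : 0 ≤ r1sq n R :=
  div_nonneg (Finset.sum_nonneg fun _ _ => sq_nonneg _) (Nat.cast_nonneg n)

lemma frobSq_eq_rdsq (hn : 2 ≤ n) : frobSq R = n * ((n : ℝ) - 1) * rdsq n R := by
  have hn' : (2 : ℝ) ≤ n := by exact_mod_cast hn
  have : (n : ℝ) - 1 ≠ 0 := by linarith
  have : (n : ℝ) ≠ 0 := by linarith
  unfold rdsq frobSq
  field_simp

lemma frobSq_centreShift_le (hn : 3 ≤ n) : frobSq (centreShift R) ≤ 72 * n ^ 2 * r1sq n R := by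
  have hn' : (3 : ℝ) ≤ n := by exact_mod_cast hn
  set α := rowShift R
  set c := (∑ l, α l) / ((n : ℝ) - 1) with hc
  have hα : ∑ l, α l ^ 2 ≤ 4 * (n * r1sq n R) := by
    have e : (n : ℝ) * r1sq n R = ∑ i, Rbar n R i ^ 2 := by
      unfold r1sq
      field_simp
    rw [e, Finset.mul_sum]
    refine Finset.sum_le_sum fun l _ => ?_
    have h1 : α l * ((n : ℝ) - 2) = Rbar n R l * (n - 1) := by
      have : (n : ℝ) - 1 ≠ 0 := by linarith
      have : (n : ℝ) - 2 ≠ 0 := by linarith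
      simp only [α, rowShift, Rbar]
      field_simp
    have h3 : (α l * ((n : ℝ) - 2)) ^ 2 ≤ 4 * Rbar n R l ^ 2 * ((n : ℝ) - 2) ^ 2 := by
      rw [h1, mul_pow]
      have : ((n : ℝ) - 1) ^ 2 ≤ 4 * ((n : ℝ) - 2) ^ 2 := by nlinarith
      nlinarith [sq_nonneg (Rbar n R l)]
    rw [mul_pow] at h3
    exact le_of_mul_le_mul_right h3 (by have : 0 < (n : ℝ) - 2 := by linarith
                                        positivity)
  have hcs : (n : ℝ) ^ 2 * c ^ 2 ≤ 4 * (n * ∑ l, α l ^ 2) := by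
    have h1 : (∑ l, α l) ^ 2 ≤ n * ∑ l, α l ^ 2 := by
      simpa using sq_sum_le_card_mul_sum_sq (s := univ) (f := α)
    have h2 : (n : ℝ) ^ 2 / ((n : ℝ) - 1) ^ 2 ≤ 4 := by
      rw [div_le_iff₀ (by have : 0 < (n : ℝ) - 1 := by linarith
                          positivity)]
      nlinarith
    calc (n : ℝ) ^ 2 * c ^ 2 = (n : ℝ) ^ 2 / ((n : ℝ) - 1) ^ 2 * (∑ l, α l) ^ 2 := by
          rw [hc, div_pow, div_mul_eq_mul_div, mul_div_assoc]
      _ ≤ 4 * (n * ∑ l, α l ^ 2) := mul_le_mul h2 h1 (sq_nonneg _) (by norm_num)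
  have h : ∀ i j, centreShift R i j ^ 2 ≤ 3 * (α i ^ 2 + α j ^ 2 + c ^ 2) := by
    intro i j
    unfold centreShift
    split_ifs
    · rw [zero_pow two_ne_zero]
      positivity
    · change (c - α i - α j) ^ 2 ≤ _
      nlinarith [sq_nonneg (α i - α j), sq_nonneg (α i + c), sq_nonneg (α j + c)]
  calc frobSq (centreShift R) ≤ ∑ i, ∑ j, 3 * (α i ^ 2 + α j ^ 2 + c ^ 2) :=
        Finset.sum_le_sum fun i _ => Finset.sum_le_sum fun j _ => h i j
    _ = 3 * (2 * (n * ∑ l, α l ^ 2) + n ^ 2 * c ^ 2) := by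
        simp only [← Finset.mul_sum, Finset.sum_add_distrib, Finset.sum_const, Finset.card_univ,
          Fintype.card_fin, nsmul_eq_mul]
        ring
    _ ≤ 18 * (n * ∑ l, α l ^ 2) := by linarith
    _ ≤ 18 * (n * (4 * (n * r1sq n R))) := by gcongr
    _ = _ := by ring

lemma schattenFour_le (hRs : ∀ i j, R i j = R j i) (hRd : ∀ i, R i i = 0) :
    schattenFour R ≤ (∑ i : Fin n, ∑ j : Fin n, ∑ k : Fin n, ∑ l : Fin n,
        if k ≠ i ∧ k ≠ j ∧ l ≠ i ∧ l ≠ j then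
          R i j * R k l * (R i k * R j l + R i l * R j k)
        else 0) / 2 + 2 * ∑ i, (∑ j, R i j ^ 2) ^ 2 := by
  set P : Fin n → Fin n → Fin n → Fin n → ℝ := fun i j k l =>
    if k ≠ i ∧ k ≠ j ∧ l ≠ i ∧ l ≠ j then R i j * R k l * (R i k * R j l) else 0 with hP
  have h1 : (∑ i : Fin n, ∑ j : Fin n, ∑ k : Fin n, ∑ l : Fin n,
        if k ≠ i ∧ k ≠ j ∧ l ≠ i ∧ l ≠ j then
          R i j * R k l * (R i k * R j l + R i l * R j k) else 0)
      = 2 * ∑ i, ∑ j, ∑ k, ∑ l, P i j k l := by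
    simp only [Finset.mul_sum]
    refine Finset.sum_congr rfl fun i _ => Finset.sum_congr rfl fun j _ => ?_
    have e : ∀ k l, (if k ≠ i ∧ k ≠ j ∧ l ≠ i ∧ l ≠ j then
          R i j * R k l * (R i k * R j l + R i l * R j k) else 0) = P i j k l + P i j l k := by
      intro k l
      simp only [hP]
      by_cases h : k ≠ i ∧ k ≠ j ∧ l ≠ i ∧ l ≠ j
      · have h' : l ≠ i ∧ l ≠ j ∧ k ≠ i ∧ k ≠ j := by tauto
        rw [if_pos h, if_pos h, if_pos h', hRs l k]
        ring
      · have h' : ¬ (l ≠ i ∧ l ≠ j ∧ k ≠ i ∧ k ≠ j) := by tauto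
        rw [if_neg h, if_neg h, if_neg h']
        ring
    simp only [e, Finset.sum_add_distrib]
    rw [Finset.sum_comm (f := fun k l => P i j l k)]
    simp only [← Finset.mul_sum]
    ring
  have h2 : schattenFour R = ∑ j, ∑ k, ∑ i, ∑ l, R i j * R i k * (R l j * R l k) := by
    simp only [schattenFour, sq, Finset.sum_mul_sum]
  have h3 : ∀ i j k l, R i j * R i k * (R l j * R l k) ≤ P i j k l
      + (if k = j then R j i ^ 2 * R j l ^ 2 else 0)
      + (if l = i then R i j ^ 2 * R i k ^ 2 else 0) := by
    intro i j k l
    simp only [hP]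
    by_cases hki : k = i
    · subst hki
      simp only [hRd]
      split_ifs <;> simp <;> positivity
    by_cases hlj : l = j
    · subst hlj
      simp only [hRd]
      split_ifs <;> simp <;> positivity
    by_cases hkj : k = j
    · subst hkj
      have : R i k * R i k * (R l k * R l k) = R k i ^ 2 * R k l ^ 2 := by
        rw [hRs i k, hRs l k]
        ring
      rw [this]
      simp
      split_ifs <;> positivity
    by_cases hli : l = i
    · subst hli
      simp [hkj]
      linarith
    · simp [hki, hlj, hkj, hli]
      rw [hRs l j, hRs l k]
      linarith
  have h4 : ∑ j, ∑ k, ∑ i, ∑ l, P i j k l = ∑ i, ∑ j, ∑ k, ∑ l, P i j k l := by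
    rw [Finset.sum_congr rfl fun j _ => Finset.sum_comm, Finset.sum_comm]
  rw [h1, h2, ← h4]
  have h5 : ∑ j, ∑ k, ∑ i, ∑ l, (if k = j then R j i ^ 2 * R j l ^ 2 else 0)
      = ∑ i, (∑ j, R i j ^ 2) ^ 2 := by
    refine Finset.sum_congr rfl fun j _ => ?_
    rw [Finset.sum_eq_single j (fun k _ hk => by simp [hk]) (by simp)]
    simp [sq (∑ i, R j i ^ 2), Finset.sum_mul_sum]
  have h6 : ∑ j, ∑ k, ∑ i, ∑ l, (if l = i then R i j ^ 2 * R i k ^ 2 else 0)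
      = ∑ i, (∑ j, R i j ^ 2) ^ 2 := by
    simp only [Finset.sum_ite_eq', mem_univ, if_true]
    rw [Finset.sum_congr rfl fun j _ => Finset.sum_comm, Finset.sum_comm]
    exact Finset.sum_congr rfl fun i _ => by rw [sq (∑ j, R i j ^ 2), Finset.sum_mul_sum]
  calc _ ≤ ∑ j, ∑ k, ∑ i, ∑ l, (P i j k l + (if k = j then R j i ^ 2 * R j l ^ 2 else 0)
      + (if l = i then R i j ^ 2 * R i k ^ 2 else 0)) :=
        Finset.sum_le_sum fun j _ => Finset.sum_le_sum fun k _ => Finset.sum_le_sum fun i _ =>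
          Finset.sum_le_sum fun l _ => h3 i j k l
    _ = _ := by
        simp only [Finset.sum_add_distrib, h5, h6]
        ring

lemma frobSq_add_le (A D : Fin n → Fin n → ℝ) :
    frobSq A ≤ 2 * frobSq (fun i j => A i j + D i j) + 2 * frobSq D := by
  unfold frobSq
  simp only [Finset.mul_sum, ← Finset.sum_add_distrib]
  exact Finset.sum_le_sum fun i _ => Finset.sum_le_sum fun j _ => by
    nlinarith [sq_nonneg (A i j + 2 * D i j)]

end MatrixConditions

section Negligibility

variable {R : (n : ℕ) → Fin n → Fin n → ℝ}

lemma rdsq_nonneg {n : ℕ} (hn : 1 ≤ n) (A : Fin n → Fin n → ℝ) : 0 ≤ rdsq n A := by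
  have : (1 : ℝ) ≤ n := by exact_mod_cast hn
  exact div_nonneg (Finset.sum_nonneg fun _ _ => Finset.sum_nonneg fun _ _ => sq_nonneg _)
    (mul_nonneg (by linarith) (by linarith))

lemma isBigO_sq_mul_rdsq : (fun n : ℕ => (n : ℝ) ^ 2 * rdsq n (R n)) =O[atTop] fun n => frobSq (R n) := by
  refine IsBigO.of_bound 2 ?_
  filter_upwards [eventually_ge_atTop 2] with n hn
  have hn' : (2 : ℝ) ≤ n := by exact_mod_cast hn
  have h0 := rdsq_nonneg (by omega) (R n)
  rw [Real.norm_of_nonneg (by positivity), Real.norm_of_nonneg (frobSq_nonneg _), frobSq_eq_rdsq hn]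
  have : (n : ℝ) ^ 2 ≤ 2 * (n * ((n : ℝ) - 1)) := by nlinarith
  calc _ ≤ 2 * (n * ((n : ℝ) - 1)) * rdsq n (R n) := by gcongr
    _ = _ := by ring

lemma isLittleO_frobSq_centreShift (hC6 : Cond6 R) :
    (fun n => frobSq (centreShift (R n))) =o[atTop] fun n => frobSq (R n) := by
  have h1 : (fun n => r1sq n (R n)) =o[atTop] fun n => rdsq n (R n) := by
    have := hC6.pow (n := 2) (by norm_num)
    refine this.congr' ?_ ?_
    · filter_upwards with n
      exact Real.sq_sqrt r1sq_nonneg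
    · filter_upwards [eventually_ge_atTop 1] with n hn
      exact Real.sq_sqrt (rdsq_nonneg hn _)
  have h2 : (fun n : ℕ => (n : ℝ) ^ 2 * r1sq n (R n)) =o[atTop] fun n : ℕ => (n : ℝ) ^ 2 * rdsq n (R n) :=
    (isBigO_refl _ _).mul_isLittleO h1
  refine IsBigO.trans_isLittleO (IsBigO.of_bound 72 ?_) (h2.trans_isBigO isBigO_sq_mul_rdsq)
  filter_upwards [eventually_ge_atTop 3] with n hn
  have h0 : 0 ≤ r1sq n (R n) := r1sq_nonneg
  rw [Real.norm_of_nonneg (frobSq_nonneg _), Real.norm_of_nonneg (by positivity)]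
  have := frobSq_centreShift_le (R := R n) hn
  linarith

lemma isLittleO_schattenFour (hsym : ∀ n (i j : Fin n), R n i j = R n j i)
    (hdiag : ∀ n (i : Fin n), R n i i = 0) (hC1 : Cond1 R) (hC5 : Cond5 R) :
    (fun n => schattenFour (R n)) =o[atTop] fun n => frobSq (R n) ^ 2 := by
  have h0 : (fun n : ℕ => (n : ℝ) ^ 4 * rdsq n (R n) ^ 2) =O[atTop] fun n => frobSq (R n) ^ 2 :=
    ((isBigO_sq_mul_rdsq (R := R)).pow 2).congr_left fun n => by ring
  have h1 : (fun n => ∑ i : Fin n, (∑ j : Fin n, (R n i j) ^ 2) ^ 2) =o[atTop]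
      fun n : ℕ => (n : ℝ) ^ 4 * rdsq n (R n) ^ 2 := by
    have h3 : (fun n : ℕ => (n : ℝ) ^ 3) =o[atTop] fun n : ℕ => (n : ℝ) ^ 4 :=
      (isLittleO_pow_pow_atTop_of_lt (by norm_num : 3 < 4)).comp_tendsto tendsto_natCast_atTop_atTop
    exact IsBigO.trans_isLittleO hC1 (h3.mul_isBigO (isBigO_refl _ _))
  have h2 := (IsLittleO.const_mul_left hC5 (2 : ℝ)⁻¹).add (h1.const_mul_left 2)
  refine IsBigO.trans_isLittleO (IsBigO.of_bound 1 ?_) (h2.trans_isBigO h0)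
  filter_upwards with n
  rw [one_mul, Real.norm_of_nonneg (schattenFour_nonneg _)]
  refine le_trans ?_ (le_abs_self _)
  refine (schattenFour_le (hsym n) (hdiag n)).trans_eq ?_
  ring

lemma eventually_frobSq_le_centred (hC6 : Cond6 R) :
    ∀ᶠ n in atTop, frobSq (R n) ≤ 4 * frobSq (centred (R n)) := by
  have h := (isLittleO_frobSq_centreShift hC6).bound (by norm_num : (0 : ℝ) < 1 / 4)
  filter_upwards [h] with n hn
  rw [Real.norm_of_nonneg (frobSq_nonneg _), Real.norm_of_nonneg (frobSq_nonneg _)] at hn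
  have : frobSq (R n) ≤ 2 * frobSq (centred (R n)) + 2 * frobSq (centreShift (R n)) :=
    frobSq_add_le _ _
  linarith

/-- The centred and normalised matrices have vanishing Schatten 4-norm. -/
lemma tendsto_schattenFour_unitCentred (hsym : ∀ n (i j : Fin n), R n i j = R n j i)
    (hdiag : ∀ n (i : Fin n), R n i i = 0) (hC1 : Cond1 R) (hC5 : Cond5 R) (hC6 : Cond6 R) :
    Tendsto (fun n => schattenFour (centred (R n)) / frobSq (centred (R n)) ^ 2) atTop (𝓝 0) := by
  have hs := isLittleO_schattenFour hsym hdiag hC1 hC5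
  have hD := isLittleO_frobSq_centreShift hC6
  have hO : (fun n => frobSq (R n)) =O[atTop] fun n => frobSq (centred (R n)) := by
    refine IsBigO.of_bound 4 ?_
    filter_upwards [eventually_frobSq_le_centred hC6] with n hn
    rwa [Real.norm_of_nonneg (frobSq_nonneg _), Real.norm_of_nonneg (frobSq_nonneg _)]
  have h1 : (fun n => 2 * (frobSq (R n) * frobSq (centreShift (R n)))) =o[atTop]
      fun n => frobSq (R n) ^ 2 :=
    (((isBigO_refl (fun n => frobSq (R n)) _).mul_isLittleO hD).const_mul_left 2).congr_right
      fun n => by ring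
  have h2 : (fun n => frobSq (centreShift (R n)) ^ 2) =o[atTop] fun n => frobSq (R n) ^ 2 :=
    hD.pow (by norm_num)
  have h3 := ((hs.add h1).add h2).const_mul_left 4
  have h4 : (fun n => schattenFour (centred (R n))) =o[atTop]
      fun n => frobSq (centred (R n)) ^ 2 := by
    refine IsBigO.trans_isLittleO (IsBigO.of_bound 1 ?_) (h3.trans_isBigO (hO.pow 2))
    filter_upwards with n
    rw [one_mul, Real.norm_of_nonneg (schattenFour_nonneg _)]
    exact (schattenFour_add_le (R n) (centreShift (R n))).trans (le_abs_self _)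
  exact h4.tendsto_div_nhds_zero

lemma frobSq_pos_of_pvar_pos {n : ℕ} {A : Fin n → Fin n → ℝ} {t1 t2 : ℕ}
    (h : 0 < pvar n (fun π => Uw n A π t1 t2)) : 0 < frobSq A := by
  refine (frobSq_nonneg A).lt_of_ne fun h0 => ?_
  have hA : ∀ i j, A i j = 0 := by
    intro i j
    have h1 := (Finset.sum_eq_zero_iff_of_nonneg
      (fun i _ => Finset.sum_nonneg fun j _ => sq_nonneg (A i j))).mp h0.symm i (mem_univ i)
    have h2 := (Finset.sum_eq_zero_iff_of_nonneg
      (fun j _ => sq_nonneg (A i j))).mp h1 j (mem_univ j)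
    exact pow_eq_zero_iff (two_ne_zero) |>.mp h2
  simp [pvar, Uw, U1, U2, hA, pexp] at h

end Negligibility

section LimitCovariance

variable {m : ℕ} {u : Fin m → ℝ}

lemma exists_label_weights (hmono : StrictMono u) (hu0 : ∀ i, 0 < u i) (hu1 : ∀ i, u i < 1) :
    ∃ p : Fin (m + 1) → ℝ, (∀ b, 0 < p b) ∧ ∑ b, p b = 1
      ∧ ∀ q : Fin m, ∑ b, p b * labelInd q.castSucc b = u q := by
  set e : ℕ → ℝ := fun j => if j = 0 then 0 else if h : j - 1 < m then u ⟨j - 1, h⟩ else 1 with he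
  have e0 : e 0 = 0 := by simp [he]
  have e1 : e (m + 1) = 1 := by simp [he]
  have eu : ∀ q : Fin m, e (q + 1) = u q := by
    intro q
    simp [he]
  refine ⟨fun b => e (b + 1) - e b, ?_, ?_, ?_⟩
  · rintro ⟨b, hb⟩
    simp only [he, Nat.add_sub_cancel]
    rcases Nat.eq_zero_or_pos b with rfl | hb0
    · simp only [Nat.add_eq_zero_iff, one_ne_zero, and_false, if_false, if_true, sub_zero]
      split_ifs
      · exact hu0 _
      · exact one_pos
    · rw [if_neg (by omega), if_neg (by omega), dif_pos (show b - 1 < m by omega), sub_pos]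
      split_ifs with h
      · exact hmono (by rw [Fin.lt_def]; simp; omega)
      · exact hu1 _
  · rw [Fin.sum_univ_eq_sum_range (fun j => e (j + 1) - e j), Finset.sum_range_sub, e0, e1, sub_zero]
  · intro q
    have h : ∀ b : Fin (m + 1), (e (b + 1) - e b) * labelInd q.castSucc b
        = (fun j : ℕ => if j < q + 1 then e (j + 1) - e j else 0) b := by
      intro b
      simp only [labelInd, Fin.le_def, Fin.val_castSucc, Nat.lt_succ_iff]
      split_ifs <;> simp
    rw [Finset.sum_congr rfl fun b _ => h b,
      Fin.sum_univ_eq_sum_range (fun j : ℕ => if j < q + 1 then e (j + 1) - e j else 0),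
      ← Finset.sum_filter]
    have : (range (m + 1)).filter (fun j => j < (q : ℕ) + 1) = range (q + 1) := by
      ext j
      have := q.2
      simp only [mem_filter, mem_range]
      omega
    rw [this, Finset.sum_range_sub, e0, eu, sub_zero]

lemma sum_mul_labelInd_sub_mul (hmono : StrictMono u) {p : Fin (m + 1) → ℝ} (hp1 : ∑ b, p b = 1)
    (hpu : ∀ q : Fin m, ∑ b, p b * labelInd q.castSucc b = u q) (q r : Fin m) :
    ∑ b, p b * ((labelInd q.castSucc b - u q) * (labelInd r.castSucc b - u r))
      = min (u q) (u r) * (1 - max (u q) (u r)) := by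
  have h : ∀ b : Fin (m + 1), labelInd q.castSucc b * labelInd r.castSucc b
      = labelInd (min q r).castSucc b := by
    intro b
    simp only [labelInd, Fin.le_def, Fin.val_castSucc, Fin.coe_min, le_min_iff]
    split_ifs <;> simp_all
  have e : ∀ b : Fin (m + 1), p b * ((labelInd q.castSucc b - u q) * (labelInd r.castSucc b - u r))
      = p b * labelInd (min q r).castSucc b - u r * (p b * labelInd q.castSucc b)
        - u q * (p b * labelInd r.castSucc b) + u q * u r * p b := by
    intro b
    rw [← h b]
    ring
  rw [Finset.sum_congr rfl fun b _ => e b, Finset.sum_add_distrib, Finset.sum_sub_distrib,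
    Finset.sum_sub_distrib, ← Finset.mul_sum, ← Finset.mul_sum, ← Finset.mul_sum, hpu, hpu, hpu,
    hp1, hmono.monotone.map_min]
  have := min_mul_max (u q) (u r)
  linear_combination this

lemma rhoW_eq {x y : ℝ} (hx0 : 0 < x) (hx1 : x < 1) (hy0 : 0 < y) (hy1 : y < 1) :
    rhoW x y = (min x y * (1 - max x y)) ^ 2 / (x * (1 - x) * (y * (1 - y))) := by
  have h1 : 0 < 1 - x := by linarith
  have h2 : 0 < 1 - y := by linarith
  unfold rhoW
  rcases le_total x y with h | h
  · rw [min_eq_left h, max_eq_right h]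
    field_simp
  · rw [min_eq_right h, max_eq_left h]
    field_simp

lemma rhoW_self {x : ℝ} (hx0 : 0 < x) (hx1 : x < 1) : rhoW x x = 1 := by
  have h1 : 0 < 1 - x := by linarith
  simp only [rhoW, min_self, max_self]
  field_simp

/-- Kernel coefficients for which the Gaussian limit has covariance `rhoW`. -/
noncomputable def limitCoeff (u a : Fin m → ℝ) (q : Fin m) : ℝ :=
  a q * (Real.sqrt (2 * (u q) ^ 2 * (1 - u q) ^ 2))⁻¹

lemma sum_labelKernel_sq {L κ : Type*} [Fintype L] [Fintype κ] [LinearOrder L] (p : L → ℝ)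
    (k : κ → L) (θ v : κ → ℝ) :
    ∑ b, ∑ c, p b * p c * labelKernel k θ v b c ^ 2
      = ∑ q, ∑ r, θ q * θ r *
        (∑ b, p b * ((labelInd (k q) b - v q) * (labelInd (k r) b - v r))) ^ 2 := by
  have h1 : ∀ b c, p b * p c * labelKernel k θ v b c ^ 2 = ∑ q, ∑ r, θ q * θ r *
      (p b * ((labelInd (k q) b - v q) * (labelInd (k r) b - v r))
        * (p c * ((labelInd (k q) c - v q) * (labelInd (k r) c - v r)))) := by
    intro b c
    rw [labelKernel, sq, Finset.sum_mul_sum, Finset.mul_sum]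
    refine Finset.sum_congr rfl fun q _ => ?_
    rw [Finset.mul_sum]
    refine Finset.sum_congr rfl fun r _ => ?_
    ring
  have h2 : ∀ q r, θ q * θ r *
        (∑ b, p b * ((labelInd (k q) b - v q) * (labelInd (k r) b - v r))) ^ 2
      = ∑ b, ∑ c, θ q * θ r *
        (p b * ((labelInd (k q) b - v q) * (labelInd (k r) b - v r))
          * (p c * ((labelInd (k q) c - v q) * (labelInd (k r) c - v r)))) := by
    intro q r
    rw [sq, Finset.sum_mul_sum]
    simp only [Finset.mul_sum]
  simp only [h1, h2]
  rw [Finset.sum_congr rfl fun b _ => Finset.sum_comm, Finset.sum_comm]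
  refine Finset.sum_congr rfl fun q _ => ?_
  rw [Finset.sum_congr rfl fun b _ => Finset.sum_comm, Finset.sum_comm]

lemma two_mul_sum_limit_kernel_sq (hmono : StrictMono u) (hu0 : ∀ i, 0 < u i) (hu1 : ∀ i, u i < 1)
    {p : Fin (m + 1) → ℝ} (hp1 : ∑ b, p b = 1)
    (hpu : ∀ q : Fin m, ∑ b, p b * labelInd q.castSucc b = u q) (a : Fin m → ℝ) :
    2 * ∑ b, ∑ c, p b * p c * labelKernel Fin.castSucc (limitCoeff u a) u b c ^ 2
      = ∑ q, ∑ r, a q * a r * rhoW (u q) (u r) := by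
  rw [sum_labelKernel_sq, Finset.mul_sum]
  refine Finset.sum_congr rfl fun q _ => ?_
  rw [Finset.mul_sum]
  refine Finset.sum_congr rfl fun r _ => ?_
  rw [sum_mul_labelInd_sub_mul hmono hp1 hpu, rhoW_eq (hu0 q) (hu1 q) (hu0 r) (hu1 r)]
  have hs : ∀ q, Real.sqrt (2 * (u q) ^ 2 * (1 - u q) ^ 2) = Real.sqrt 2 * (u q * (1 - u q)) := by
    intro q
    have := hu0 q
    have := hu1 q
    rw [mul_assoc, ← mul_pow, Real.sqrt_mul (by norm_num), Real.sqrt_sq]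
    exact mul_nonneg (by linarith) (by linarith)
  simp only [limitCoeff, hs]
  have h20 : Real.sqrt 2 ≠ 0 := by positivity
  have h1 := (hu0 q).ne'
  have h3 := (hu0 r).ne'
  have h4 : 1 - u q ≠ 0 := by have := hu1 q; linarith
  have h5 : 1 - u r ≠ 0 := by have := hu1 r; linarith
  generalize min (u q) (u r) * (1 - max (u q) (u r)) = X
  have h2 : Real.sqrt 2 ^ 2 = 2 := Real.sq_sqrt (by norm_num)
  field_simp
  rw [h2]
  ring

lemma labelKernel_mixed_difference (θ v : Fin m → ℝ) (q : Fin m) :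
    labelKernel Fin.castSucc θ v q.castSucc q.castSucc
      - labelKernel Fin.castSucc θ v q.succ q.castSucc
      - labelKernel Fin.castSucc θ v q.castSucc q.succ
      + labelKernel Fin.castSucc θ v q.succ q.succ = θ q := by
  simp only [labelKernel, ← Finset.sum_sub_distrib, ← Finset.sum_add_distrib]
  rw [Finset.sum_eq_single q]
  · simp only [labelInd, le_refl, if_true, if_neg (not_le.2 (Fin.castSucc_lt_succ (i := q)))]
    ring
  · intro r _ hr
    have : labelInd r.castSucc q.castSucc = labelInd r.castSucc q.succ := by
      simp only [labelInd, Fin.le_def, Fin.val_castSucc, Fin.val_succ]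
      have : (r : ℕ) ≠ q := fun h => hr (Fin.ext h)
      split_ifs <;> first | rfl | omega
    rw [this]
    ring
  · simp

lemma posDef_rhoW (hmono : StrictMono u) (hu0 : ∀ i, 0 < u i) (hu1 : ∀ i, u i < 1) :
    (Matrix.of fun i j : Fin m => rhoW (u i) (u j)).PosDef := by
  obtain ⟨p, hp, hp1, hpu⟩ := exists_label_weights hmono hu0 hu1
  refine Matrix.PosDef.of_dotProduct_mulVec_pos ?_ ?_
  · ext i j
    simp [rhoW, min_comm, max_comm]
  · intro x hx
    have e : star x ⬝ᵥ ((Matrix.of fun i j : Fin m => rhoW (u i) (u j)).mulVec x)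
        = ∑ q, ∑ r, x q * x r * rhoW (u q) (u r) := by
      simp only [dotProduct, Matrix.mulVec, Matrix.of_apply, star_trivial, Finset.mul_sum]
      refine Finset.sum_congr rfl fun q _ => Finset.sum_congr rfl fun r _ => ?_
      ring
    rw [e, ← two_mul_sum_limit_kernel_sq hmono hu0 hu1 hp1 hpu x]
    have hnn : ∀ b c, 0 ≤ p b * p c * labelKernel Fin.castSucc (limitCoeff u x) u b c ^ 2 :=
      fun b c => mul_nonneg (mul_pos (hp b) (hp c)).le (sq_nonneg _)
    have h0 : 0 ≤ ∑ b, ∑ c, p b * p c * labelKernel Fin.castSucc (limitCoeff u x) u b c ^ 2 :=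
      Finset.sum_nonneg fun b _ => Finset.sum_nonneg fun c _ => hnn b c
    refine mul_pos two_pos (lt_of_le_of_ne h0 fun h => hx ?_)
    have hz : ∀ b c, labelKernel Fin.castSucc (limitCoeff u x) u b c = 0 := by
      intro b c
      have h1 := (Finset.sum_eq_zero_iff_of_nonneg
        fun b _ => Finset.sum_nonneg fun c _ => hnn b c).1 h.symm b (mem_univ _)
      have h2 := (Finset.sum_eq_zero_iff_of_nonneg fun c _ => hnn b c).1 h1 c (mem_univ _)
      have h3 := (mul_pos (hp b) (hp c)).ne'
      simpa [h3] using h2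
    ext q
    have := labelKernel_mixed_difference (limitCoeff u x) u q
    simp only [hz, sub_zero, add_zero] at this
    have hs : Real.sqrt (2 * (u q) ^ 2 * (1 - u q) ^ 2) ≠ 0 := by
      have := hu0 q
      have : 0 < 1 - u q := by have := hu1 q; linarith
      positivity
    simpa [limitCoeff, hs] using this.symm

end LimitCovariance

section CharFun

variable {n : ℕ}

lemma charFun_permDist (f : Equiv.Perm (Fin n) → ℝ) (s : ℝ) :
    charFun (permDist n f : Measure ℝ) s
      = permAvg (fun π => Complex.exp (Complex.I * ↑(s * f π))) := by
  rw [charFun_apply_real]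
  have hf : Measurable f := fun _ _ => trivial
  have : (permDist n f : Measure ℝ)
      = ((PMF.uniformOfFintype (Equiv.Perm (Fin n))).toMeasure).map f := rfl
  rw [this, integral_map hf.aemeasurable (by fun_prop), PMF.integral_eq_sum, permAvg,
    Finset.smul_sum]
  refine Finset.sum_congr rfl fun π _ => ?_
  rw [PMF.uniformOfFintype_apply, Fintype.card_perm, Fintype.card_fin, ENNReal.toReal_inv,
    ENNReal.toReal_natCast]
  push_cast
  ring_nf

lemma charFun_gaussLimit {v : ℝ} (hv : 0 ≤ v) (s : ℝ) :
    charFun (gaussLimit v : Measure ℝ) s = Complex.exp (-(s ^ 2 * (v / 2) : ℝ)) := by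
  have : (gaussLimit v : Measure ℝ) = gaussianReal 0 v.toNNReal := rfl
  rw [this, charFun_gaussianReal]
  congr 1
  simp only [Real.coe_toNNReal _ hv]
  push_cast
  ring

lemma norm_exp_I_mul_sub_le (x y : ℝ) :
    ‖Complex.exp (Complex.I * x) - Complex.exp (Complex.I * y)‖ ≤ |x - y| := by
  have e : Complex.exp (Complex.I * x) - Complex.exp (Complex.I * y)
      = Complex.exp (Complex.I * y) * (Complex.exp (Complex.I * ↑(x - y)) - 1) := by
    rw [mul_sub, ← Complex.exp_add, mul_one]
    congr 2
    push_cast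
    ring
  rw [e, norm_mul, Complex.norm_exp_I_mul_ofReal, one_mul]
  exact Real.norm_exp_I_mul_ofReal_sub_one_le

end CharFun

section Assembly

variable {n m : ℕ} {B : Fin n → Fin n → ℝ}

lemma pexp_abs_headSum_le (hBs : ∀ i j, B i j = B j i) (hBd : ∀ i, B i i = 0)
    (hB0 : ∀ i, ∑ j, B i j = 0) (hB1 : ∑ i, ∑ j, B i j ^ 2 = 1) (hn : 6 ≤ n) {t : ℕ} (ht : t ≤ n) :
    pexp n (fun π => |headSum B t π|) ≤ 17 := by
  have h1 := pexp_abs_le_add (n := n) (f := headSum B t) one_pos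
  have h2 := pexp_headSum_sub_sq_le hBs hBd hB0 hB1 hn ht (Nat.zero_le n)
  have h0 : ∀ π, headSum B 0 π = 0 := fun π => by simp [headSum, headInd]
  simp only [h0, sub_zero, Nat.cast_zero, Nat.abs_cast] at h2
  have hn' : (0 : ℝ) < n := by exact_mod_cast (by omega : 0 < n)
  have ht' : (t : ℝ) ≤ n := by exact_mod_cast ht
  have h3 : 32 * (t : ℝ) / n ≤ 32 := by
    rw [div_le_iff₀ hn']
    linarith
  have h4 : (0 : ℝ) ≤ t := t.cast_nonneg
  linarith

lemma norm_permAvg_exp_headSum_sub_le (hBs : ∀ i j, B i j = B j i) (hBd : ∀ i, B i i = 0)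
    (hB0 : ∀ i, ∑ j, B i j = 0) (hB1 : ∑ i, ∑ j, B i j ^ 2 = 1) (hn : 6 ≤ n)
    {L : Type*} [LinearOrder L] [Fintype L] {κ : Type*} [Fintype κ]
    {p : L → ℝ} (hp : ∀ b, 0 ≤ p b) (hp1 : ∑ b, p b = 1) (k : κ → L) (c θ : κ → ℝ) {v : κ → ℝ}
    (hv : ∀ q, ∑ b, p b * labelInd (k q) b = v q) (hv0 : ∀ q, 0 ≤ v q) (hv1 : ∀ q, v q ≤ 1)
    {t : κ → ℕ} (ht : ∀ q, t q ≤ n) (htv : ∀ q, |(t q : ℝ) - n * v q| ≤ 1) {δ : ℝ} (hδ : 0 < δ)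
    (hQ : schattenFour B ≤ δ ^ 2) (s : ℝ) :
    ‖permAvg (fun π => Complex.exp (Complex.I * ↑(s * ∑ q, c q * headSum B (t q) π)))
        - Complex.exp (-(s ^ 2 * ∑ x, ∑ y, p x * p y * labelKernel k θ v x y ^ 2 : ℝ))‖
      ≤ |s| * (17 * ∑ q, |c q - θ q|) + |s| * (∑ q, |θ q|) * (17 * Real.sqrt ((Real.sqrt n + 1) / n))
        + (40 * (∑ q, |θ q|) ^ 2 * s ^ 2
            + 12 * |s| ^ 3 * (2 * (∑ q, |θ q|) ^ 2 + 5 * (∑ q, |θ q|) ^ 4)) * δ := by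
  set F : ℝ → ℂ := fun x => Complex.exp (Complex.I * ↑(s * x)) with hFdef
  have hF : ∀ x y, ‖F x - F y‖ ≤ |s| * |x - y| := by
    intro x y
    rw [← abs_mul, mul_sub]
    exact norm_exp_I_mul_sub_le _ _
  have hn' : (0 : ℝ) < n := by exact_mod_cast (by omega : 0 < n)
  set η := Real.sqrt ((Real.sqrt n + 1) / n) with hη
  have hη0 : 0 < η := by positivity
  have hη2 : (Real.sqrt n + 1) / n = η * η := (Real.mul_self_sqrt (by positivity)).symm
  have h1 : ‖permAvg (fun π => F (∑ q, c q * headSum B (t q) π))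
      - permAvg (fun π => F (∑ q, θ q * headSum B (t q) π))‖
      ≤ |s| * (17 * ∑ q, |c q - θ q|) := by
    refine (norm_permAvg_sub_le _ _).trans ?_
    calc _ ≤ pexp n (fun π => |s| * ∑ q, |c q - θ q| * |headSum B (t q) π|) := by
          refine pexp_mono fun π => (hF _ _).trans ?_
          gcongr
          rw [← Finset.sum_sub_distrib]
          refine (Finset.abs_sum_le_sum_abs _ _).trans (le_of_eq ?_)
          refine Finset.sum_congr rfl fun q _ => ?_
          rw [← sub_mul, abs_mul]
      _ = |s| * ∑ q, |c q - θ q| * pexp n (fun π => |headSum B (t q) π|) := by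
          rw [pexp_const_mul, pexp_sum]
          simp only [pexp_const_mul]
      _ ≤ |s| * ∑ q, |c q - θ q| * 17 := by
          gcongr with q
          exact pexp_abs_headSum_le hBs hBd hB0 hB1 hn (ht q)
      _ = _ := by rw [← Finset.sum_mul, mul_comm 17]
  have h2 := norm_prodExp_labelSum_sub_le hBs hBd hB0 hB1 hn hp hp1 k θ v hv ht htv (abs_nonneg s)
    hη0 hF
  have h3 := norm_prodExp_exp_quadForm_sub_le hp hp1 hBs hBd hB1 (labelKernel_comm k θ v)
    (sum_mul_labelKernel hp1 θ hv) (abs_labelKernel_le k θ hv0 hv1) hδ hQ s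
  simp only [quadForm_labelKernel hBs hB0] at h3
  have h2' : |s| * (∑ q, |θ q|) * (η / 2 + 16 / η * ((Real.sqrt n + 1) / n))
      ≤ |s| * (∑ q, |θ q|) * (17 * η) := by
    have : 0 ≤ ∑ q, |θ q| := Finset.sum_nonneg fun q _ => abs_nonneg _
    gcongr
    rw [hη2]
    field_simp
    linarith
  rw [norm_sub_rev] at h2
  refine (norm_sub_le_norm_sub_add_norm_sub _ (permAvg (fun π => F (∑ q, θ q * headSum B (t q) π)))
    _).trans ?_
  have h4 := norm_sub_le_norm_sub_add_norm_sub (permAvg (fun π => F (∑ q, θ q * headSum B (t q) π)))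
    (prodExp p (fun ω => F (∑ q, θ q * labelSum B (k q) ω)))
    (Complex.exp (-(s ^ 2 * ∑ x, ∑ y, p x * p y * labelKernel k θ v x y ^ 2 : ℝ)))
  linarith

end Assembly

section Limits

lemma tendsto_floor_mul_div {x : ℝ} (hx : 0 ≤ x) :
    Tendsto (fun n : ℕ => (⌊(n : ℝ) * x⌋₊ : ℝ) / n) atTop (𝓝 x) := by
  have := (tendsto_nat_floor_mul_div_atTop hx).comp (tendsto_natCast_atTop_atTop (R := ℝ))
  simpa only [Function.comp_def, mul_comm x] using this

lemma tendsto_headSum_variance {t : ℕ → ℕ} {x : ℝ}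
    (ht : Tendsto (fun n : ℕ => (t n : ℝ) / n) atTop (𝓝 x)) :
    Tendsto (fun n : ℕ => 2 * (t n : ℝ) * ((t n : ℝ) - 1) * ((n : ℝ) - t n) * (n - t n - 1) /
      (n * (n - 1) * (n - 2) * (n - 3))) atTop (𝓝 (2 * x ^ 2 * (1 - x) ^ 2)) := by
  have hy : Tendsto (fun n : ℕ => 1 / (n : ℝ)) atTop (𝓝 0) := tendsto_one_div_atTop_nhds_zero_nat
  have hnum := (((ht.const_mul 2).mul (ht.sub hy)).mul (ht.const_sub 1)).mul
    ((ht.const_sub 1).sub hy)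
  have hden := ((hy.const_sub 1).mul ((hy.const_mul 2).const_sub 1)).mul
    ((hy.const_mul 3).const_sub 1)
  have h := hnum.div hden (by norm_num)
  have e : 2 * x * (x - 0) * (1 - x) * (1 - x - 0) / ((1 - 0) * (1 - 2 * 0) * (1 - 3 * 0))
      = 2 * x ^ 2 * (1 - x) ^ 2 := by ring
  rw [e] at h
  refine h.congr' ?_
  filter_upwards [eventually_ge_atTop 4] with n hn
  have hn' : (4 : ℝ) ≤ n := by exact_mod_cast hn
  have h0 : (n : ℝ) ≠ 0 := by linarith
  have h1 : (n : ℝ) - 1 ≠ 0 := by linarith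
  have h2 : (n : ℝ) - 2 ≠ 0 := by linarith
  have h3 : (n : ℝ) - 3 ≠ 0 := by linarith
  have h1' : 1 - 1 / (n : ℝ) ≠ 0 := by rw [one_sub_div h0]; positivity
  have h2' : 1 - 2 * (1 / (n : ℝ)) ≠ 0 := by
    rw [mul_one_div, one_sub_div h0]; positivity
  have h3' : 1 - 3 * (1 / (n : ℝ)) ≠ 0 := by
    rw [mul_one_div, one_sub_div h0]; positivity
  simp only [Pi.div_apply]
  rw [div_eq_div_iff (by positivity) (by positivity)]
  field_simp

lemma tendsto_sqrt_natCast_add_one_div :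
    Tendsto (fun n : ℕ => Real.sqrt ((Real.sqrt n + 1) / n)) atTop (𝓝 0) := by
  have hy : Tendsto (fun n : ℕ => 1 / (n : ℝ)) atTop (𝓝 0) := tendsto_one_div_atTop_nhds_zero_nat
  have h := ((Real.continuous_sqrt.tendsto 0).comp hy).add hy
  have h' := (Real.continuous_sqrt.tendsto _).comp h
  simp only [Real.sqrt_zero, add_zero] at h'
  refine h'.congr fun n => ?_
  simp only [Function.comp_apply]
  congr 1
  rw [add_div, Real.sqrt_div zero_le_one, Real.sqrt_one, Real.sqrt_div_self']

end Limits

end RING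

/-- Under Conditions (C1)–(C6), for every `m ≥ 1` and `0 < u_1 < … < u_m < 1`,
the vector `(Z_w^π(⌊n·u_1⌋), …, Z_w^π(⌊n·u_m⌋))` converges in distribution under
the permutation null to a centered Gaussian vector with covariance matrix
`C_{ij} = ρ_w*(u_i,u_j)`, a positive definite matrix with unit diagonal.
Multivariate convergence in distribution is expressed through the Cramér–Wold
device: every linear combination `Σ_i a_i Z_w^π(⌊n·u_i⌋)` converges in
distribution to `N(0, aᵀCa)`. -/
theorem stmt9 (R : (n : ℕ) → Fin n → Fin n → ℝ)
    (hsym : ∀ n (i j : Fin n), R n i j = R n j i) (hdiag : ∀ n (i : Fin n), R n i i = 0)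
    (hC1 : Cond1 R) (hC2 : Cond2 R) (hC3 : Cond3 R) (hC4 : Cond4 R)
    (hC5 : Cond5 R) (hC6 : Cond6 R)
    (m : ℕ) (hm : 1 ≤ m) (u : Fin m → ℝ) (hmono : StrictMono u)
    (hu0 : ∀ i, 0 < u i) (hu1 : ∀ i, u i < 1)
    (hvar : ∀ i : Fin m, ∀ᶠ n in atTop,
      0 < pvar n (fun π => Uw n (R n) π 0 ⌊(n : ℝ) * u i⌋₊)
      ∧ 0 < pvar n (fun π => Udiff n (R n) π 0 ⌊(n : ℝ) * u i⌋₊)) :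
    (Matrix.of fun i j : Fin m => rhoW (u i) (u j)).PosDef
    ∧ (∀ i : Fin m, rhoW (u i) (u i) = 1)
    ∧ ∀ a : Fin m → ℝ,
        Tendsto
          (fun n => permDist n (fun π => ∑ i : Fin m, a i * Zw n (R n) π 0 ⌊(n : ℝ) * u i⌋₊))
          atTop
          (𝓝 (gaussLimit (∑ i : Fin m, ∑ j : Fin m, a i * a j * rhoW (u i) (u j)))) := by
  refine ⟨posDef_rhoW hmono hu0 hu1, fun i => rhoW_self (hu0 i) (hu1 i), fun a => ?_⟩
  obtain ⟨p, hp, hp1, hpu⟩ := exists_label_weights hmono hu0 hu1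
  set θ := limitCoeff u a with hθ
  set μ := ∑ b, ∑ c, p b * p c * labelKernel Fin.castSucc θ u b c ^ 2 with hμ
  have hσ : ∑ i, ∑ j, a i * a j * rhoW (u i) (u j) = 2 * μ :=
    (two_mul_sum_limit_kernel_sq hmono hu0 hu1 hp1 hpu a).symm
  have hμ0 : 0 ≤ μ := Finset.sum_nonneg fun b _ => Finset.sum_nonneg fun c _ =>
    mul_nonneg (mul_pos (hp b) (hp c)).le (sq_nonneg _)
  rw [hσ, ProbabilityMeasure.tendsto_iff_tendsto_charFun]
  intro s
  rw [charFun_gaussLimit (by positivity), mul_div_cancel_left₀ μ two_ne_zero]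
  simp only [charFun_permDist]
  set t : ℕ → Fin m → ℕ := fun n q => ⌊(n : ℝ) * u q⌋₊ with ht
  set c : ℕ → Fin m → ℝ := fun n q => a q * (Real.sqrt (2 * (t n q : ℝ) * ((t n q : ℝ) - 1)
    * ((n : ℝ) - t n q) * (n - t n q - 1) / (n * (n - 1) * (n - 2) * (n - 3))))⁻¹ with hc
  have hcθ : ∀ q, Tendsto (fun n => c n q) atTop (𝓝 (θ q)) := by
    intro q
    have h := tendsto_headSum_variance (tendsto_floor_mul_div (hu0 q).le)
    have h' : 0 < 1 - u q := by have := hu1 q; linarith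
    have h0 := hu0 q
    exact ((((Real.continuous_sqrt.tendsto _).comp h).inv₀
      (by positivity : Real.sqrt (2 * u q ^ 2 * (1 - u q) ^ 2) ≠ 0))).const_mul (a q)
  set δ : ℕ → ℝ := fun n => Real.sqrt (schattenFour (centred (R n)) / frobSq (centred (R n)) ^ 2)
    + 1 / (n : ℝ) with hδ
  have hδ0 : Tendsto δ atTop (𝓝 0) := by
    have h := ((Real.continuous_sqrt.tendsto 0).comp
      (tendsto_schattenFour_unitCentred hsym hdiag hC1 hC5 hC6)).add
      (tendsto_one_div_atTop_nhds_zero_nat (𝕜 := ℝ))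
    simpa [hδ] using h
  have hbound : Tendsto (fun n : ℕ => |s| * (17 * ∑ q, |c n q - θ q|)
      + |s| * (∑ q, |θ q|) * (17 * Real.sqrt ((Real.sqrt n + 1) / n))
      + (40 * (∑ q, |θ q|) ^ 2 * s ^ 2
          + 12 * |s| ^ 3 * (2 * (∑ q, |θ q|) ^ 2 + 5 * (∑ q, |θ q|) ^ 4)) * δ n) atTop (𝓝 0) := by
    have h1 : Tendsto (fun n => ∑ q, |c n q - θ q|) atTop (𝓝 0) := by
      have := tendsto_finsetSum (univ : Finset (Fin m))
        fun q _ => ((hcθ q).sub_const (θ q)).abs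
      simpa using this
    have h := (((h1.const_mul 17).const_mul |s|).add
      ((tendsto_sqrt_natCast_add_one_div.const_mul 17).const_mul (|s| * ∑ q, |θ q|))).add
      (hδ0.const_mul (40 * (∑ q, |θ q|) ^ 2 * s ^ 2
          + 12 * |s| ^ 3 * (2 * (∑ q, |θ q|) ^ 2 + 5 * (∑ q, |θ q|) ^ 4)))
    simpa using h
  rw [tendsto_iff_norm_sub_tendsto_zero]
  refine squeeze_zero' (Eventually.of_forall fun _ => norm_nonneg _) ?_ hbound
  filter_upwards [eventually_ge_atTop 6, hvar ⟨0, hm⟩, eventually_frobSq_le_centred hC6]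
    with n hn hvarn hfr
  have hf : 0 < frobSq (centred (R n)) := by
    have := frobSq_pos_of_pvar_pos hvarn.1
    linarith
  have hn' : (0 : ℝ) < n := by exact_mod_cast (by omega : 0 < n)
  have htn : ∀ q, t n q ≤ n := by
    intro q
    refine Nat.floor_le_of_le ?_
    nlinarith [hu1 q]
  have htu : ∀ q, |(t n q : ℝ) - n * u q| ≤ 1 := by
    intro q
    have h1 := Nat.floor_le (mul_pos hn' (hu0 q)).le
    have h2 := Nat.lt_floor_add_one ((n : ℝ) * u q)
    rw [abs_le]
    constructor <;> linarith
  have hBs : ∀ i j, unitCentred (R n) i j = unitCentred (R n) j i := fun i j => by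
    rw [unitCentred, unitCentred, centred_comm (hsym n)]
  have hBd : ∀ i, unitCentred (R n) i i = 0 := fun i => by
    rw [unitCentred, centred_self (hdiag n), mul_zero]
  have hB0 : ∀ i, ∑ j, unitCentred (R n) i j = 0 := fun i => by
    simp only [unitCentred, ← Finset.mul_sum, sum_centred (R := R n) (by omega : 3 ≤ n), mul_zero]
  have hδn : 0 < δ n := by positivity
  have hQ : schattenFour (unitCentred (R n)) ≤ δ n ^ 2 := by
    rw [schattenFour_unitCentred hf]
    refine (Real.sqrt_le_left hδn.le).1 ?_
    exact le_add_of_nonneg_right (by positivity)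
  have key := norm_permAvg_exp_headSum_sub_le hBs hBd hB0 (frobSq_unitCentred hf) hn
    (fun b => (hp b).le) hp1 Fin.castSucc (c n) θ hpu (fun q => (hu0 q).le) (fun q => (hu1 q).le)
    htn htu hδn hQ s
  have hZ : ∀ π, ∑ q, a q * Zw n (R n) π 0 ⌊(n : ℝ) * u q⌋₊
      = ∑ q, c n q * headSum (unitCentred (R n)) (t n q) π := fun π =>
    Finset.sum_congr rfl fun q _ => by
      rw [Zw_eq (hsym n) (hdiag n) (by omega) hf (htn q), ← mul_assoc]
  simp only [hZ]
  exact key
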